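/- arXiv:2410.07496 — 13 statements merged into one kernel-verified Lean document; each statement's English description precedes it below -/
import Mathlib

section
/- Let g be a vector space over a field K equipped with two bilinear multiplications · and •. For s,t ∈ K define x ·_{s,t} y = s(x·y) + t(x•y). Then (g, ·_{s,t}) is a perm algebra for every choice of s,t ∈ K if and only if (g,·) and (g,•) are both perm algebras and for all x,y,z ∈ g: (x•y)·z + (x·y)•z = x·(y•z) + x•(y·z) = x·(z•y) + x•(z·y). -/
/-- A (right) perm product: (x·y)·z = x·(y·z) = x·(z·y). -/
def IsPerm {g : Type*} (m : g → g → g) : Prop :=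
  ∀ x y z, m (m x y) z = m x (m y z) ∧ m x (m y z) = m x (m z y)

/-- Equal sums with equal outer terms have equal middle terms. -/
theorem mixed_eq_of_add_eq {g : Type*} [AddCommGroup g] {a b c a' b' c' : g}
    (h : a + b + c = a' + b' + c') (ha : a = a') (hc : c = c') : b = b' := by
  subst ha hc
  exact add_left_cancel (add_right_cancel h)

section Pencil

variable {K g : Type*} [CommRing K] [AddCommGroup g] [Module K g]
  (mul1 mul2 : g →ₗ[K] g →ₗ[K] g)

theorem pencil_mul_left (s t : K) (x y z : g) :
    s • mul1 (s • mul1 x y + t • mul2 x y) z + t • mul2 (s • mul1 x y + t • mul2 x y) z =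
      (s * s) • mul1 (mul1 x y) z + (s * t) • (mul1 (mul2 x y) z + mul2 (mul1 x y) z) +
        (t * t) • mul2 (mul2 x y) z := by
  simp only [map_add, map_smul, LinearMap.add_apply, LinearMap.smul_apply]
  module

theorem pencil_mul_right (s t : K) (x y z : g) :
    s • mul1 x (s • mul1 y z + t • mul2 y z) + t • mul2 x (s • mul1 y z + t • mul2 y z) =
      (s * s) • mul1 x (mul1 y z) + (s * t) • (mul1 x (mul2 y z) + mul2 x (mul1 y z)) +
        (t * t) • mul2 x (mul2 y z) := by
  simp only [map_add, map_smul]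
  module

end Pencil

/-- `(g, ·_{s,t})` is a perm algebra for every `s, t ∈ K` iff
`(g,·)` and `(g,•)` are perm algebras and the compatibility conditions hold. -/
theorem stmt0 {K g : Type*} [Field K] [AddCommGroup g] [Module K g]
    (mul1 mul2 : g →ₗ[K] g →ₗ[K] g) :
    (∀ s t : K, IsPerm (fun x y => s • mul1 x y + t • mul2 x y)) ↔
      (IsPerm (fun x y => mul1 x y) ∧ IsPerm (fun x y => mul2 x y) ∧
        ∀ x y z : g,
          (mul1 (mul2 x y) z + mul2 (mul1 x y) z
              = mul1 x (mul2 y z) + mul2 x (mul1 y z)) ∧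
          (mul1 x (mul2 y z) + mul2 x (mul1 y z)
              = mul1 x (mul2 z y) + mul2 x (mul1 z y))) := by
  simp only [IsPerm, pencil_mul_left, pencil_mul_right]
  constructor
  · intro h
    have h₁ : IsPerm (fun x y => mul1 x y) := fun x y z => by simpa using h 1 0 x y z
    have h₂ : IsPerm (fun x y => mul2 x y) := fun x y z => by simpa using h 0 1 x y z
    refine ⟨h₁, h₂, fun x y z => ?_⟩
    have h₁₂ := h 1 1 x y z
    simp only [mul_one, one_smul] at h₁₂
    exact ⟨mixed_eq_of_add_eq h₁₂.1 (h₁ x y z).1 (h₂ x y z).1,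
      mixed_eq_of_add_eq h₁₂.2 (h₁ x y z).2 (h₂ x y z).2⟩
  · rintro ⟨h₁, h₂, h₁₂⟩ s t x y z
    exact ⟨by rw [(h₁ x y z).1, (h₂ x y z).1, (h₁₂ x y z).1],
      by rw [(h₁ x y z).2, (h₂ x y z).2, (h₁₂ x y z).2]⟩
end

section
/- Let g be a vector space over a field K with two bilinear multiplications · and •, let V be a K-vector space, and let η^ℓ, η^r, τ^ℓ, τ^r : g → End(V) be linear maps. For s,t ∈ K set x ·_{s,t} y = s(x·y) + t(x•y), ℓ^{s,t} = sη^ℓ + tτ^ℓ and ρ^{s,t} = sη^r + tτ^r. Then (V, ℓ^{s,t}, ρ^{s,t}) satisfies the representation equations with respect to (g, ·_{s,t}) for every s,t ∈ K if and only if (V, η^ℓ, η^r) is a representation of (g,·), (V, τ^ℓ, τ^r) is a representation of (g,•), and for all x,y ∈ g, u ∈ V: η^ℓ(x•y)u + τ^ℓ(x·y)u = η^ℓ(x)(τ^ℓ(y)u) + τ^ℓ(x)(η^ℓ(y)u) = η^ℓ(x)(u τ^r(y)) + τ^ℓ(x)(u η^r(y)) = (τ^ℓ(x)u) η^r(y)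 + (η^ℓ(x)u) τ^r(y), and u η^r(x•y) + u τ^r(x·y) = (u τ^r(y)) η^r(x) + (u η^r(y)) τ^r(x) = (u τ^r(x)) η^r(y) + (u η^r(x)) τ^r(y). -/
/-- The representation equations of a perm-type multiplication `m`:
`v ρ(m x y) = (v ρ(x)) ρ(y) = (v ρ(y)) ρ(x)` and
`ℓ(m x y) v = ℓ(x)(ℓ(y)v) = ℓ(x)(v ρ(y)) = (ℓ(x)v) ρ(y)`. -/
def IsRep {g V : Type*} (m : g → g → g) (l r : g → V → V) : Prop :=
  ∀ x y v,
    r (m x y) v = r y (r x v) ∧ r y (r x v) = r x (r y v) ∧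
    l (m x y) v = l x (l y v) ∧ l x (l y v) = l x (r y v) ∧
    l x (r y v) = r y (l x v)

/-- `(V, sη^ℓ+tτ^ℓ, sη^r+tτ^r)` satisfies the representation
equations with respect to `(g, ·_{s,t})` for all `s,t ∈ K` iff
`(V,η^ℓ,η^r)` is a representation of `(g,·)`, `(V,τ^ℓ,τ^r)` is a
representation of `(g,•)`, and the displayed compatibility equations hold. -/
theorem stmt1 {K g V : Type*} [Field K] [AddCommGroup g] [Module K g]
    [AddCommGroup V] [Module K V]
    (mul1 mul2 : g →ₗ[K] g →ₗ[K] g)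
    (ηl ηr τl τr : g →ₗ[K] Module.End K V) :
    (∀ s t : K, IsRep (fun x y => s • mul1 x y + t • mul2 x y)
        (fun x v => s • ηl x v + t • τl x v)
        (fun x v => s • ηr x v + t • τr x v)) ↔
      (IsRep (fun x y => mul1 x y) (fun x v => ηl x v) (fun x v => ηr x v) ∧
       IsRep (fun x y => mul2 x y) (fun x v => τl x v) (fun x v => τr x v) ∧
        ∀ (x y : g) (u : V),
          (ηl (mul2 x y) u + τl (mul1 x y) u = ηl x (τl y u) + τl x (ηl y u)) ∧
          (ηl x (τl y u) + τl x (ηl y u) = ηl x (τr y u) + τl x (ηr y u)) ∧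
          (ηl x (τr y u) + τl x (ηr y u) = ηr y (τl x u) + τr y (ηl x u)) ∧
          (ηr (mul2 x y) u + τr (mul1 x y) u = ηr x (τr y u) + τr x (ηr y u)) ∧
          (ηr x (τr y u) + τr x (ηr y u) = ηr y (τr x u) + τr y (ηr x u))) := by
  constructor
  · intro h
    have h₁ : IsRep (fun x y => mul1 x y) (fun x v => ηl x v) (fun x v => ηr x v) := by
      simpa using h 1 0
    have h₂ : IsRep (fun x y => mul2 x y) (fun x v => τl x v) (fun x v => τr x v) := by
      simpa using h 0 1
    refine ⟨h₁, h₂, fun x y u => ?_⟩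
    obtain ⟨a₁, a₂, a₃, a₄, a₅⟩ := h₁ x y u
    obtain ⟨b₁, b₂, b₃, b₄, b₅⟩ := h₂ x y u
    obtain ⟨c₁, c₂, c₃, c₄, c₅⟩ := h 1 1 x y u
    simp only [one_smul, map_add, LinearMap.add_apply] at a₁ a₂ a₃ a₄ a₅ b₁ b₂ b₃ b₄ b₅ c₁ c₂ c₃ c₄ c₅
    refine ⟨?_, ?_, ?_, ?_, ?_⟩
    · linear_combination (norm := module) c₃ - a₃ - b₃
    · linear_combination (norm := module) c₄ - a₄ - b₄
    · linear_combination (norm := module) c₅ - a₅ - b₅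
    · linear_combination (norm := module) c₁ - a₁ - b₁ + c₂ - a₂ - b₂
    · linear_combination (norm := module) a₂ + b₂ - c₂
  · rintro ⟨h₁, h₂, h₃⟩ s t x y u
    obtain ⟨a₁, a₂, a₃, a₄, a₅⟩ := h₁ x y u
    obtain ⟨b₁, b₂, b₃, b₄, b₅⟩ := h₂ x y u
    obtain ⟨c₁, c₂, c₃, c₄, c₅⟩ := h₃ x y u
    simp only [map_add, map_smul, LinearMap.add_apply, LinearMap.smul_apply] at *
    refine ⟨?_, ?_, ?_, ?_, ?_⟩
    · linear_combination (norm := module) (s * s) • a₁ + (t * t) • b₁ + (s * t) • (c₄ + c₅)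
    · linear_combination (norm := module) (s * s) • a₂ + (t * t) • b₂ - (s * t) • c₅
    · linear_combination (norm := module) (s * s) • a₃ + (t * t) • b₃ + (s * t) • c₁
    · linear_combination (norm := module) (s * s) • a₄ + (t * t) • b₄ + (s * t) • c₂
    · linear_combination (norm := module) (s * s) • a₅ + (t * t) • b₅ + (s * t) • c₃
end

section
/- Let g carry two bilinear multiplications · and • such that (g,·) and (g,•) are perm algebras satisfying (x•y)·z + (x·y)•z = x·(y•z) + x•(y·z) = x·(z•y) + x•(z·y) (so that each ·_{s,t} = s· + t• is a perm product). Let (V, η^ℓ, η^r) be a representation of (g,·) and (V, τ^ℓ, τ^r) a representation of (g,•), and assume (V, sη^ℓ+tτ^ℓ, sη^r+tτ^r) is a representation of (g, ·_{s,t}) for all s,t ∈ K. Let N ∈ End(g) and α ∈ End(V). Then for every s,t ∈ K the pair (s·id_g + tN, s·id_V + tα) is a homomorphism of representations from (V, sη^ℓ+tτ^ℓ, sη^r+tτ^r) over (g, ·_{s,t}) to (V, η^ℓ, η^r) over (g,·) if and only if for all x,y ∈ g and v ∈ V: (i) x•y = N(x)·y + x·N(y) − N(x·y); (ii) N(x•y)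 = N(x)·N(y); (iii) τ^ℓ(x)v = η^ℓ(N(x))v + η^ℓ(x)(α(v)) − α(η^ℓ(x)v); (iv) α(τ^ℓ(x)v) = η^ℓ(N(x))(α(v)); (v) v τ^r(x) = v η^r(N(x)) + (α(v)) η^r(x) − α(v η^r(x)); (vi) α(v τ^r(x)) = (α(v)) η^r(N(x)). -/
/-- A pencil of bilinear maps is intertwined by `s + t f` and `s + t h` for all scalars `s`, `t`
iff the coefficients of `s * t` and `t ^ 2` agree; this holds over every field, since the values
at `(0, 1)` and `(1, 1)` already determine both coefficients. -/
theorem pencil_intertwines_iff {K A B : Type*} [Field K] [AddCommGroup A] [Module K A]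
    [AddCommGroup B] [Module K B] (m m' : A →ₗ[K] B →ₗ[K] B) (f : A →ₗ[K] A) (h : B →ₗ[K] B)
    (x : A) (y : B) :
    (∀ s t : K, s • (s • m x y + t • m' x y) + t • h (s • m x y + t • m' x y)
        = m (s • x + t • f x) (s • y + t • h y)) ↔
      m' x y = m (f x) y + m x (h y) - h (m x y) ∧ h (m' x y) = m (f x) (h y) := by
  constructor
  · intro H
    have H01 : h (m' x y) = m (f x) (h y) := by simpa using H 0 1
    have H11 := H 1 1
    simp only [one_smul, map_add, LinearMap.add_apply, H01] at H11
    refine ⟨?_, H01⟩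
    rw [eq_sub_iff_add_eq, ← sub_eq_zero]
    rw [← sub_eq_zero] at H11
    rw [← H11]
    abel
  · rintro ⟨H1, H2⟩ s t
    simp only [map_add, map_smul, LinearMap.add_apply, LinearMap.smul_apply, H2]
    rw [H1]
    module

/-- `(s·id_g + tN, s·id_V + tα)` is a homomorphism of
representations from `(V, sη^ℓ+tτ^ℓ, sη^r+tτ^r)` over `(g,·_{s,t})` to
`(V,η^ℓ,η^r)` over `(g,·)` for every `s,t ∈ K` iff conditions (i)-(vi) hold. -/
theorem stmt2 {K g V : Type*} [Field K] [AddCommGroup g] [Module K g]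
    [AddCommGroup V] [Module K V]
    (mul1 mul2 : g →ₗ[K] g →ₗ[K] g)
    (h1 : IsPerm (fun x y => mul1 x y)) (h2 : IsPerm (fun x y => mul2 x y))
    (hcompat : ∀ x y z : g,
      (mul1 (mul2 x y) z + mul2 (mul1 x y) z
          = mul1 x (mul2 y z) + mul2 x (mul1 y z)) ∧
      (mul1 x (mul2 y z) + mul2 x (mul1 y z)
          = mul1 x (mul2 z y) + mul2 x (mul1 z y)))
    (ηl ηr τl τr : g →ₗ[K] Module.End K V)
    (hrep1 : IsRep (fun x y => mul1 x y) (fun x v => ηl x v) (fun x v => ηr x v))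
    (hrep2 : IsRep (fun x y => mul2 x y) (fun x v => τl x v) (fun x v => τr x v))
    (hrepst : ∀ s t : K, IsRep (fun x y => s • mul1 x y + t • mul2 x y)
        (fun x v => s • ηl x v + t • τl x v)
        (fun x v => s • ηr x v + t • τr x v))
    (N : g →ₗ[K] g) (α : V →ₗ[K] V) :
    (∀ s t : K,
      (∀ x y : g,
        s • (s • mul1 x y + t • mul2 x y) + t • N (s • mul1 x y + t • mul2 x y)
          = mul1 (s • x + t • N x) (s • y + t • N y)) ∧
      (∀ (x : g) (v : V),
        s • (s • ηl x v + t • τl x v) + t • α (s • ηl x v + t • τl x v)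
          = ηl (s • x + t • N x) (s • v + t • α v)) ∧
      (∀ (x : g) (v : V),
        s • (s • ηr x v + t • τr x v) + t • α (s • ηr x v + t • τr x v)
          = ηr (s • x + t • N x) (s • v + t • α v))) ↔
    (∀ (x y : g) (v : V),
      (mul2 x y = mul1 (N x) y + mul1 x (N y) - N (mul1 x y)) ∧
      (N (mul2 x y) = mul1 (N x) (N y)) ∧
      (τl x v = ηl (N x) v + ηl x (α v) - α (ηl x v)) ∧
      (α (τl x v) = ηl (N x) (α v)) ∧
      (τr x v = ηr (N x) v + ηr x (α v) - α (ηr x v)) ∧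
      (α (τr x v) = ηr (N x) (α v))) := by
  constructor
  · intro H x y v
    have hm := (pencil_intertwines_iff mul1 mul2 N N x y).1 fun s t => (H s t).1 x y
    have hl := (pencil_intertwines_iff ηl τl N α x v).1 fun s t => (H s t).2.1 x v
    have hr := (pencil_intertwines_iff ηr τr N α x v).1 fun s t => (H s t).2.2 x v
    exact ⟨hm.1, hm.2, hl.1, hl.2, hr.1, hr.2⟩
  · intro H s t
    refine ⟨fun x y => ?_, fun x v => ?_, fun x v => ?_⟩
    · obtain ⟨hi, hii, -⟩ := H x y 0
      exact (pencil_intertwines_iff mul1 mul2 N N x y).2 ⟨hi, hii⟩ s t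
    · obtain ⟨-, -, hiii, hiv, -⟩ := H x 0 v
      exact (pencil_intertwines_iff ηl τl N α x v).2 ⟨hiii, hiv⟩ s t
    · obtain ⟨-, -, -, -, hv, hvi⟩ := H x 0 v
      exact (pencil_intertwines_iff ηr τr N α x v).2 ⟨hv, hvi⟩ s t
end

section
/- Let (g,N) be a Nijenhuis perm algebra, (V,ℓ,ρ) a representation of the perm algebra (g,·), and α : V → V a linear map. On g ⊕ V define the bilinear product (x+u) ∗ (y+v) = x·y + ℓ(x)v + u ρ(y) and the linear map (N⊕α)(x+u) = N(x) + α(u). Then (g ⊕ V, ∗) is a perm algebra, and N⊕α is a Nijenhuis operator on (g ⊕ V, ∗) if and only if (V,ℓ,ρ,α) is a representation of the Nijenhuis perm algebra (g,N). -/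
/-- A Nijenhuis operator on `(g, m)`. -/
def IsNij {g : Type*} [Add g] (m : g → g → g) (N : g → g) : Prop :=
  ∀ x y, m (N x) (N y) + N (N (m x y)) = N (m (N x) y) + N (m x (N y))

/-- A representation of a Nijenhuis perm algebra `(g, m, N)`. -/
def IsNijRep {g V : Type*} [Add V] (m : g → g → g) (N : g → g)
    (l r : g → V → V) (α : V → V) : Prop :=
  IsRep m l r ∧ ∀ x v,
    (l (N x) (α v) + α (α (l x v)) = α (l (N x) v) + α (l x (α v))) ∧
    (r (N x) (α v) + α (α (r x v)) = α (r (N x) v) + α (r x (α v)))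

/-- the semidirect product `g ⊕ V` is a perm algebra, and
`N ⊕ α` is a Nijenhuis operator on it iff `(V,ℓ,ρ,α)` is a representation of
the Nijenhuis perm algebra `(g,N)`. -/
theorem stmt3 {K g V : Type*} [Field K] [AddCommGroup g] [Module K g]
    [AddCommGroup V] [Module K V]
    (mul : g →ₗ[K] g →ₗ[K] g) (hm : IsPerm (fun x y => mul x y))
    (l r : g →ₗ[K] Module.End K V)
    (hrep : IsRep (fun x y => mul x y) (fun x v => l x v) (fun x v => r x v))
    (N : g →ₗ[K] g) (hN : IsNij (fun x y => mul x y) N) (α : V →ₗ[K] V) :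
    IsPerm (fun p q : g × V => (mul p.1 q.1, l p.1 q.2 + r q.1 p.2)) ∧
    (IsNij (fun p q : g × V => (mul p.1 q.1, l p.1 q.2 + r q.1 p.2))
        (fun p => (N p.1, α p.2)) ↔
      IsNijRep (fun x y => mul x y) N (fun x v => l x v) (fun x v => r x v)
        (fun v => α v)) := by
  refine ⟨?_, ?_, ?_⟩
  · rintro ⟨x, u⟩ ⟨y, v⟩ ⟨z, w⟩
    have hmul := hm x y z
    obtain ⟨hr, hrr, -⟩ := hrep y z u
    obtain ⟨hr', -⟩ := hrep z y u
    obtain ⟨-, -, hl, hlr, -⟩ := hrep x y w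
    obtain ⟨-, -, -, hlr', hlr''⟩ := hrep x z v
    simp only at hmul hr hrr hr' hl hlr hlr' hlr''
    refine ⟨Prod.ext hmul.1 ?_, Prod.ext hmul.2 ?_⟩
    · simp only [map_add, hr, hl, hlr'']
      abel
    · simp only [map_add, hr, hr', hrr, hlr, hlr']
      abel
  · intro h
    refine ⟨hrep, fun x v => ⟨?_, ?_⟩⟩
    · simpa using congrArg Prod.snd (h (x, 0) (0, v))
    · simpa [add_comm] using congrArg Prod.snd (h (0, v) (x, 0))
  · rintro ⟨-, h⟩ ⟨x, u⟩ ⟨y, v⟩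
    refine Prod.ext (hN x y) ?_
    have hl := (h x v).1
    have hr := (h y u).2
    simp only [Prod.snd_add, map_add] at hl hr ⊢
    rw [add_add_add_comm, hl, hr]
    abel
end

section
/- Let (g,N) be a Nijenhuis perm algebra, (V,ℓ,ρ) a representation of the perm algebra (g,·), and β : V → V a linear map. Define ℓ*, ρ* : g → End(V*) by (ℓ*(x)ξ)(v) = ξ(ℓ(x)v) and (ξ ρ*(x))(v) = ξ(v ρ(x)). Then (V*, ρ* − ℓ*, ρ*, β*) is a representation of the Nijenhuis perm algebra (g,N), where β* is the dual map of β, if and only if for all x ∈ g and u ∈ V: β(ℓ(N(x))u) + ℓ(x)(β²(u)) − ℓ(N(x))(β(u)) − β(ℓ(x)(β(u))) = 0 and β(u ρ(N(x))) + (β²(u)) ρ(x) − (β(u)) ρ(N(x)) − β((β(u)) ρ(x)) = 0. -/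
/-- The dual `(V*, ρ* − ℓ*, ρ*)` of a representation of a perm algebra is a representation. -/
theorem IsRep.dual {K g V : Type*} [Field K] [AddCommGroup V] [Module K V] {m : g → g → g}
    {l r : g → Module.End K V} (h : IsRep m (fun x v => l x v) (fun x v => r x v)) :
    IsRep m (fun x ξ => ξ ∘ₗ (r x) - ξ ∘ₗ (l x) : g → Module.Dual K V → Module.Dual K V)
      (fun x ξ => ξ ∘ₗ (r x)) := by
  intro x y ξ
  simp only [IsRep] at h
  refine ⟨?_, ?_, ?_, ?_, ?_⟩ <;> ext v <;>
    obtain ⟨h1, h2, h3, h4, h5⟩ := h x y v <;>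
    obtain ⟨-, -, -, k4, -⟩ := h y x v <;>
    simp only [LinearMap.comp_apply, LinearMap.sub_apply, h1, h2, h3, h4, ← h5, k4] <;>
    ring

/-- `(V*, ρ*−ℓ*, ρ*, β*)` is a representation of the Nijenhuis
perm algebra `(g,N)` iff the two displayed equations hold. -/
theorem stmt4 {K g V : Type*} [Field K] [AddCommGroup g] [Module K g]
    [AddCommGroup V] [Module K V]
    (mul : g →ₗ[K] g →ₗ[K] g) (hm : IsPerm (fun x y => mul x y))
    (l r : g →ₗ[K] Module.End K V)
    (hrep : IsRep (fun x y => mul x y) (fun x v => l x v) (fun x v => r x v))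
    (N : g →ₗ[K] g) (hN : IsNij (fun x y => mul x y) N) (β : V →ₗ[K] V) :
    IsNijRep (fun x y => mul x y) N
        (fun x ξ => ξ ∘ₗ (r x) - ξ ∘ₗ (l x) : g → Module.Dual K V → Module.Dual K V)
        (fun x ξ => ξ ∘ₗ (r x))
        (fun ξ => ξ ∘ₗ β) ↔
      ∀ (x : g) (u : V),
        (β (l (N x) u) + l x (β (β u)) - l (N x) (β u) - β (l x (β u)) = 0) ∧
        (β (r (N x) u) + r x (β (β u)) - r (N x) (β u) - β (r x (β u)) = 0) := by
  constructor
  · rintro ⟨-, h⟩ x u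
    have hr : β (r (N x) u) + r x (β (β u)) - r (N x) (β u) - β (r x (β u)) = 0 := by
      rw [← Module.forall_dual_apply_eq_zero_iff K]
      intro ξ
      have h2 := LinearMap.congr_fun (h x ξ).2 u
      simp only [LinearMap.comp_apply, LinearMap.add_apply, map_sub, map_add] at h2 ⊢
      linear_combination h2
    refine ⟨?_, hr⟩
    rw [← Module.forall_dual_apply_eq_zero_iff K]
    intro ξ
    have h1 := LinearMap.congr_fun (h x ξ).1 u
    have h2 := congrArg ξ hr
    simp only [LinearMap.comp_apply, LinearMap.add_apply, LinearMap.sub_apply, map_sub, map_add,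
      map_zero] at h1 h2 ⊢
    linear_combination h2 - h1
  · refine fun h => ⟨hrep.dual, fun x ξ => ⟨?_, ?_⟩⟩ <;> ext u <;>
      have h1 := congrArg ξ (h x u).1 <;> have h2 := congrArg ξ (h x u).2 <;>
      simp only [LinearMap.comp_apply, LinearMap.add_apply, LinearMap.sub_apply, map_sub, map_add,
        map_zero] at h1 h2 ⊢
    · linear_combination h2 - h1
    · linear_combination h2
end

section
/- Let (g,N_g) and (h,N_h) be Nijenhuis perm algebras with products · on g and ∘ on h, let ℓ_g, r_g : g → End(h) and ℓ_h, r_h : h → End(g) be linear maps such that (h, ℓ_g, r_g) is a representation of (g,·), (g, ℓ_h, r_h) is a representation of (h,∘), and the bilinear operation (a+x) ⋆ (b+y) = a·b + ℓ_h(x)b + a r_h(y) + x∘y + ℓ_g(a)y + x r_g(b) makes g ⊕ h a perm algebra. Define N_{g+h}(a+x) = N_g(a) + N_h(x). Then N_{g+h} is a Nijenhuis operator on (g ⊕ h, ⋆) if and only if (h, ℓ_g, r_g, N_h) is a representation of the Nijenhuis perm algebra (g,N_g) and (g, ℓ_h, r_h, N_g) is a representation of the Nijenhuis perm algebra (h,N_h).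 -/
/-- `N_{g+h}` is a Nijenhuis operator on `(g ⊕ h, ⋆)` iff
`(h, ℓ_g, r_g, N_h)` is a representation of `(g,N_g)` and
`(g, ℓ_h, r_h, N_g)` is a representation of `(h,N_h)`. -/
theorem stmt7 {K g h : Type*} [Field K] [AddCommGroup g] [Module K g]
    [AddCommGroup h] [Module K h]
    (mulg : g →ₗ[K] g →ₗ[K] g) (mulh : h →ₗ[K] h →ₗ[K] h)
    (hg : IsPerm (fun x y => mulg x y)) (hh : IsPerm (fun x y => mulh x y))
    (lg rg : g →ₗ[K] Module.End K h) (lh rh : h →ₗ[K] Module.End K g)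
    (hrep1 : IsRep (fun x y => mulg x y) (fun x v => lg x v) (fun x v => rg x v))
    (hrep2 : IsRep (fun x y => mulh x y) (fun x v => lh x v) (fun x v => rh x v))
    (Ng : g →ₗ[K] g) (Nh : h →ₗ[K] h)
    (hNg : IsNij (fun x y => mulg x y) Ng) (hNh : IsNij (fun x y => mulh x y) Nh)
    (hstar : IsPerm (fun p q : g × h =>
      (mulg p.1 q.1 + lh p.2 q.1 + rh q.2 p.1,
       mulh p.2 q.2 + lg p.1 q.2 + rg q.1 p.2))) :
    IsNij (fun p q : g × h =>
        (mulg p.1 q.1 + lh p.2 q.1 + rh q.2 p.1,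
         mulh p.2 q.2 + lg p.1 q.2 + rg q.1 p.2))
      (fun p => (Ng p.1, Nh p.2)) ↔
    (IsNijRep (fun x y => mulg x y) Ng (fun x v => lg x v) (fun x v => rg x v)
        (fun v => Nh v) ∧
     IsNijRep (fun x y => mulh x y) Nh (fun x v => lh x v) (fun x v => rh x v)
        (fun v => Ng v)) := by
  constructor
  · intro H
    refine ⟨⟨hrep1, fun x v => ⟨?_, ?_⟩⟩, ⟨hrep2, fun x v => ⟨?_, ?_⟩⟩⟩
    · simpa using congrArg Prod.snd (H (x, 0) (0, v))
    · simpa [add_comm] using congrArg Prod.snd (H (0, v) (x, 0))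
    · simpa using congrArg Prod.fst (H (0, x) (v, 0))
    · simpa [add_comm] using congrArg Prod.fst (H (v, 0) (0, x))
  · rintro ⟨⟨-, H₁⟩, ⟨-, H₂⟩⟩ ⟨a, x⟩ ⟨b, y⟩
    have hab := hNg a b
    have hxy := hNh x y
    have hl₁ := (H₁ a y).1
    have hr₁ := (H₁ b x).2
    have hl₂ := (H₂ x b).1
    have hr₂ := (H₂ y a).2
    simp only at hab hxy hl₁ hr₁ hl₂ hr₂
    ext
    · simp only [Prod.fst_add, map_add]
      linear_combination (norm := abel) hab + hl₂ + hr₂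
    · simp only [Prod.snd_add, map_add]
      linear_combination (norm := abel) hxy + hl₁ + hr₁
end

section
/- Let (g,·) be a perm algebra and B a bilinear form on g that is skew-symmetric (B(x,y) = −B(y,x)) and invariant, i.e. B(x·y, z) = B(y, z·x) − B(y, x·z) for all x,y,z ∈ g. Then B(x·y, z) = B(x, z·y) for all x,y,z ∈ g. -/
/-- a skew-symmetric invariant bilinear form on a perm algebra
satisfies `B(x·y, z) = B(x, z·y)`. -/
theorem stmt8 {K g : Type*} [Field K] [AddCommGroup g] [Module K g]
    (mul : g →ₗ[K] g →ₗ[K] g) (hm : IsPerm (fun x y => mul x y))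
    (B : g →ₗ[K] g →ₗ[K] K)
    (hskew : ∀ x y : g, B x y = - B y x)
    (hinv : ∀ x y z : g, B (mul x y) z = B y (mul z x) - B y (mul x z)) :
    ∀ x y z : g, B (mul x y) z = B x (mul z y) := by
  intro x y z
  linear_combination hinv y x z + hinv y z x - hskew x (mul y z) - hskew z (mul y x)
    + hskew z (mul x y)
end

section
/- Let (g,N) be a Nijenhuis perm algebra, B a nondegenerate skew-symmetric invariant bilinear form on (g,·), and N̂ : g → g a linear map satisfying B(N(x), y) = B(x, N̂(y)) for all x,y ∈ g. Then: (i) N̂ is admissible to (g,N), i.e. N̂(N(x)·y) + x·N̂²(y) = N(x)·N̂(y) + N̂(x·N̂(y)) and N̂(x·N(y)) + N̂²(x)·y = N̂(x)·N(y) + N̂(N̂(x)·y) for all x,y ∈ g; (ii) defining ℓ*, ρ* : g → End(g*) by (ℓ*(x)ξ)(v) = ξ(x·v) and (ξ ρ*(x))(v) = ξ(v·x), the quadruple (g*, ρ*−ℓ*, ρ*, N̂*) is a representation of the Nijenhuis perm algebra (g,N); (iii) the map ψ : g → g*, ψ(x)(y) = B(x,y), is a linear bijection satisfying ψ(x·y)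 = (ρ*−ℓ*)(x)(ψ(y)), ψ(y·x) = ψ(y) ρ*(x), and ψ(N(x)) = N̂*(ψ(x)) for all x,y ∈ g, so that ψ is an equivalence of representations of (g,N) from the adjoint representation (g, L, R, N) (where L(x)y = x·y and y R(x) = y·x) to (g*, ρ*−ℓ*, ρ*, N̂*). -/
/-- for a Nijenhuis perm algebra `(g,N)` with a nondegenerate
skew-symmetric invariant bilinear form `B` and adjoint `N̂` of `N`:
(i) `N̂` is admissible to `(g,N)`; (ii) `(g*, ρ*−ℓ*, ρ*, N̂*)` is a
representation of `(g,N)`; (iii) `ψ = B(·,−)` is a linear bijection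
intertwining the adjoint representation `(g,L,R,N)` with
`(g*, ρ*−ℓ*, ρ*, N̂*)`. -/
theorem stmt9 {K g : Type*} [Field K] [AddCommGroup g] [Module K g]
    (mul : g →ₗ[K] g →ₗ[K] g) (hm : IsPerm (fun x y => mul x y))
    (N : g →ₗ[K] g) (hN : IsNij (fun x y => mul x y) N)
    (B : g →ₗ[K] g →ₗ[K] K)
    (hskew : ∀ x y : g, B x y = - B y x)
    (hinv : ∀ x y z : g, B (mul x y) z = B y (mul z x) - B y (mul x z))
    (hnd : Function.Bijective fun x : g => (B x : Module.Dual K g))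
    (Nhat : g →ₗ[K] g)
    (hNhat : ∀ x y : g, B (N x) y = B x (Nhat y)) :
    -- (i) N̂ is admissible to (g,N)
    (∀ x y : g,
      (Nhat (mul (N x) y) + mul x (Nhat (Nhat y))
          = mul (N x) (Nhat y) + Nhat (mul x (Nhat y))) ∧
      (Nhat (mul x (N y)) + mul (Nhat (Nhat x)) y
          = mul (Nhat x) (N y) + Nhat (mul (Nhat x) y))) ∧
    -- (ii) (g*, ρ*−ℓ*, ρ*, N̂*) is a representation of (g,N)
    IsNijRep (fun x y => mul x y) N
      (fun x ξ => ξ ∘ₗ (mul.flip x) - ξ ∘ₗ (mul x) :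
        g → Module.Dual K g → Module.Dual K g)
      (fun x ξ => ξ ∘ₗ (mul.flip x))
      (fun ξ => ξ ∘ₗ Nhat) ∧
    -- (iii) ψ is a linear bijection and an equivalence of representations
    (Function.Bijective (fun x : g => (B x : Module.Dual K g)) ∧
      (∀ x y : g, B (mul x y) = (B y) ∘ₗ (mul.flip x) - (B y) ∘ₗ (mul x)) ∧
      (∀ x y : g, B (mul y x) = (B y) ∘ₗ (mul.flip x)) ∧
      (∀ x : g, B (N x) = (B x) ∘ₗ Nhat)) := by
  have hinj : ∀ a b : g, (∀ z, B z a = B z b) → a = b := fun a b h =>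
    hnd.1 (LinearMap.ext fun z => by
      change B a z = B b z
      rw [hskew a, hskew b, h])
  have hright : ∀ x y z : g, B (mul y x) z = B y (mul z x) := fun x y z => by
    rw [hinv, hskew y, hinv]; ring
  have hL : ∀ x y z : g, B z (mul x y) = B (mul z x) y - B (mul x z) y := fun x y z => by
    rw [hskew z, hinv, hskew y, hskew y]; ring
  have hR : ∀ x y z : g, B z (mul x y) = B (mul z y) x := fun x y z => (hright y z x).symm
  have hBN : ∀ x y z : g, B (mul (N x) (N y)) z + B (N (N (mul x y))) z
      = B (N (mul (N x) y)) z + B (N (mul x (N y))) z := fun x y z => by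
    simpa using congrArg (fun w => B w z) (hN x y)
  have hadm : ∀ x y : g,
      (Nhat (mul (N x) y) + mul x (Nhat (Nhat y))
          = mul (N x) (Nhat y) + Nhat (mul x (Nhat y))) ∧
      (Nhat (mul x (N y)) + mul (Nhat (Nhat x)) y
          = mul (Nhat x) (N y) + Nhat (mul (Nhat x) y)) := by
    refine fun x y => ⟨hinj _ _ fun z => ?_, hinj _ _ fun z => ?_⟩
    · simp only [map_add, ← hNhat, hL]
      linear_combination hBN z x y - hBN x z y
    · simp only [map_add, ← hNhat, hR]
      linear_combination hBN z y x
  refine ⟨hadm, ⟨fun x y ξ => ?_, fun x ξ => ⟨?_, ?_⟩⟩, hnd, fun x y => ?_, fun x y => ?_,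
    fun x => ?_⟩
  · have h1 : ∀ a b c : g, mul (mul a b) c = mul a (mul b c) := fun a b c => (hm a b c).1
    have h2 : ∀ a b c : g, ξ (mul a (mul b c)) = ξ (mul a (mul c b)) :=
      fun a b c => congrArg ξ (hm a b c).2
    refine ⟨?_, ?_, ?_, ?_, ?_⟩ <;> ext v <;>
      simp only [LinearMap.comp_apply, LinearMap.sub_apply, LinearMap.flip_apply, h1]
    · exact h2 v x y
    · exact h2 v y x
    · linear_combination h2 y v x - h2 x y v
    · linear_combination h2 y x v
    · linear_combination h2 v x y
  · ext v
    have e1 := congrArg ξ (hadm x v).1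
    have e2 := congrArg ξ (hadm v x).2
    simp only [map_add] at e1 e2
    simp only [LinearMap.comp_apply, LinearMap.sub_apply, LinearMap.add_apply,
      LinearMap.flip_apply]
    linear_combination e2 - e1
  · ext v
    simpa using congrArg ξ (hadm v x).2
  · ext z
    simpa using hinv x y z
  · ext z
    exact hright x y z
  · ext z
    exact hNhat x z
end

section
/- Let (g,·) be a perm algebra, N a Nijenhuis operator on g, S : g → g admissible to (g,N), and r = Σᵢ uᵢ⊗vᵢ ∈ g⊗g. Write (S⊗id − id⊗N)(r) = Σₖ pₖ⊗p′ₖ and (N⊗id − id⊗S)(r) = Σₘ qₘ⊗q′ₘ. Then the Nijenhuis perm coalgebra identity (S⊗S)Δ_r(x) + Δ_r(S²(x)) = (S⊗id)Δ_r(S(x)) + (id⊗S)Δ_r(S(x)) holds for all x ∈ g if and only if for all x ∈ g: Σₖ pₖ ⊗ (S(x·p′ₖ) − S(p′ₖ·x) − S(x)·p′ₖ + p′ₖ·S(x)) + Σₘ (S(x)·qₘ − S(x·qₘ)) ⊗ q′ₘ = 0. -/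
open TensorProduct

/-- `S` is admissible to `(g, m, N)`. -/
def IsAdm {g : Type*} [Add g] (m : g → g → g) (N S : g → g) : Prop :=
  ∀ x y,
    (S (m (N x) y) + m x (S (S y)) = m (N x) (S y) + S (m x (S y))) ∧
    (S (m x (N y)) + m (S (S x)) y = m (S x) (N y) + S (m (S x) y))

/-- The comultiplication `Δ_r(x) = Σᵢ (x·uᵢ ⊗ vᵢ + uᵢ ⊗ x·vᵢ − uᵢ ⊗ vᵢ·x)`. -/
noncomputable def Dr {K g : Type*} [Field K] [AddCommGroup g] [Module K g]
    {ι : Type*} [Fintype ι] (mul : g →ₗ[K] g →ₗ[K] g) (u v : ι → g)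
    (x : g) : g ⊗[K] g :=
  ∑ i, (mul x (u i) ⊗ₜ[K] v i + u i ⊗ₜ[K] mul x (v i) - u i ⊗ₜ[K] mul (v i) x)

/-- the Nijenhuis perm coalgebra identity for `S` and `Δ_r`
holds for all `x` iff the displayed tensor identity holds for all `x`. -/
theorem stmt10 {K g : Type*} [Field K] [AddCommGroup g] [Module K g]
    {ι κ μ : Type*} [Fintype ι] [Fintype κ] [Fintype μ]
    (mul : g →ₗ[K] g →ₗ[K] g) (hm : IsPerm (fun x y => mul x y))
    (N S : g →ₗ[K] g) (hN : IsNij (fun x y => mul x y) N)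
    (hS : IsAdm (fun x y => mul x y) N S)
    (u v : ι → g) (p p' : κ → g) (q q' : μ → g)
    (hp : ∑ k, p k ⊗ₜ[K] p' k
        = ∑ i, (S (u i) ⊗ₜ[K] v i - u i ⊗ₜ[K] N (v i)))
    (hq : ∑ m, q m ⊗ₜ[K] q' m
        = ∑ i, (N (u i) ⊗ₜ[K] v i - u i ⊗ₜ[K] S (v i))) :
    (∀ x : g,
      TensorProduct.map S S (Dr mul u v x) + Dr mul u v (S (S x))
        = TensorProduct.map S LinearMap.id (Dr mul u v (S x))
          + TensorProduct.map LinearMap.id S (Dr mul u v (S x))) ↔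
    (∀ x : g,
      (∑ k, p k ⊗ₜ[K]
          (S (mul x (p' k)) - S (mul (p' k) x)
            - mul (S x) (p' k) + mul (p' k) (S x)))
        + (∑ m, (mul (S x) (q m) - S (mul x (q m))) ⊗ₜ[K] q' m) = 0) := by
  refine forall_congr' fun x => ?_
  rw [← sub_eq_zero]
  refine Eq.congr_left ?_
  let A : g →ₗ[K] g :=
    S ∘ₗ mul x - S ∘ₗ mul.flip x - mul (S x) + mul.flip (S x)
  let B : g →ₗ[K] g := mul (S x) - S ∘ₗ mul x
  have hA := congrArg (TensorProduct.map LinearMap.id A) hp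
  have hB := congrArg (TensorProduct.map B LinearMap.id) hq
  simp only [map_sum, map_sub, TensorProduct.map_tmul, LinearMap.id_apply, A, B,
    LinearMap.sub_apply, LinearMap.add_apply, LinearMap.comp_apply,
    LinearMap.flip_apply] at hA hB
  rw [hA, hB]
  simp only [Dr, map_sum, map_sub, map_add, TensorProduct.map_tmul, LinearMap.id_apply,
    ← Finset.sum_add_distrib, ← Finset.sum_sub_distrib]
  refine Finset.sum_congr rfl fun i _ => ?_
  have left_adm : mul (S (S x)) (u i)
      = mul (S x) (N (u i)) + S (mul (S x) (u i)) - S (mul x (N (u i))) :=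
    eq_sub_of_add_eq' (hS x (u i)).2
  have right_adm : mul (S (S x)) (v i)
      = mul (S x) (N (v i)) + S (mul (S x) (v i)) - S (mul x (N (v i))) :=
    eq_sub_of_add_eq' (hS x (v i)).2
  have right_adm' : mul (v i) (S (S x))
      = mul (N (v i)) (S x) + S (mul (v i) (S x)) - S (mul (N (v i)) x) :=
    eq_sub_of_add_eq' (hS (v i) x).1
  rw [left_adm, right_adm, right_adm']
  simp only [tmul_add, tmul_sub, add_tmul, sub_tmul]
  abel
end

section
/- Let (g,·) be a perm algebra, N a Nijenhuis operator on g, and S : g → g a linear map admissible to (g,N). Let r = Σᵢ uᵢ⊗vᵢ ∈ g⊗g be symmetric (τ(r) = r) and suppose r satisfies the classical perm Yang–Baxter equation P(r) = 0 and the admissibility condition (S⊗id)(r) = (id⊗N)(r). Then, with Δ_r(x) = Σᵢ (x·uᵢ ⊗ vᵢ + uᵢ ⊗ x·vᵢ − uᵢ ⊗ vᵢ·x): (a) (g, Δ_r) is a perm coalgebra; (b) S is a Nijenhuis operator on the perm coalgebra (g, Δ_r), i.e. (S⊗S)Δ_r(x) + Δ_r(S²(x)) = (S⊗id)Δ_r(S(x))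 + (id⊗S)Δ_r(S(x)) for all x; (c) (S⊗id)Δ_r(N(x)) + (id⊗N²)Δ_r(x) = (S⊗N)Δ_r(x) + (id⊗N)Δ_r(N(x)) for all x; (d) (id⊗S)Δ_r(N(x)) + (N²⊗id)Δ_r(x) = (N⊗S)Δ_r(x) + (N⊗id)Δ_r(N(x)) for all x. -/
open TensorProduct

/-- A perm coalgebra. -/
def IsPermCoalg {K g : Type*} [Field K] [AddCommGroup g] [Module K g]
    (Δ : g →ₗ[K] g ⊗[K] g) : Prop :=
  ∀ x : g,
    (TensorProduct.assoc K g g g) ((TensorProduct.map Δ LinearMap.id) (Δ x))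
        = (TensorProduct.map LinearMap.id Δ) (Δ x) ∧
    (TensorProduct.map LinearMap.id Δ) (Δ x)
        = (TensorProduct.map LinearMap.id
            ((TensorProduct.comm K g g).toLinearMap ∘ₗ Δ)) (Δ x)

/-- The linear map `Δ_r : x ↦ Σᵢ (x·uᵢ ⊗ vᵢ + uᵢ ⊗ x·vᵢ − uᵢ ⊗ vᵢ·x)`. -/
noncomputable def Dmap {K g : Type*} [Field K] [AddCommGroup g] [Module K g]
    {ι : Type*} [Fintype ι] (mul : g →ₗ[K] g →ₗ[K] g) (u v : ι → g) :
    g →ₗ[K] g ⊗[K] g :=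
  ∑ i, (((TensorProduct.mk K g g).flip (v i)) ∘ₗ (mul.flip (u i))
        + (TensorProduct.mk K g g (u i)) ∘ₗ (mul.flip (v i))
        - (TensorProduct.mk K g g (u i)) ∘ₗ (mul (v i)))

section PermYangBaxter

variable {K g M : Type*} [Field K] [AddCommGroup g] [Module K g] [AddCommGroup M] [Module K M]
  {ι : Type*} [Fintype ι]

theorem Dmap_apply (mul : g →ₗ[K] g →ₗ[K] g) (u v : ι → g) (x : g) :
    Dmap mul u v x = ∑ i, (mul x (u i) ⊗ₜ[K] v i + u i ⊗ₜ[K] mul x (v i)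
      - u i ⊗ₜ[K] mul (v i) x) := by
  simp [Dmap]

variable {mul : g →ₗ[K] g →ₗ[K] g} {u v : ι → g}

theorem sum_sum_tmul_symm
    (hsymm : ∑ i, v i ⊗ₜ[K] u i = ∑ i, u i ⊗ₜ[K] v i)
    (F : g ⊗[K] (g ⊗[K] g) →ₗ[K] M) (c : ι → g) (A B : ι → g →ₗ[K] g) :
    ∑ i, ∑ j, F (c i ⊗ₜ (A i (v j) ⊗ₜ B i (u j)))
      = ∑ i, ∑ j, F (c i ⊗ₜ (A i (u j) ⊗ₜ B i (v j))) := by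
  refine Finset.sum_congr rfl fun i _ => ?_
  simpa using congrArg (F ∘ₗ TensorProduct.mk K g (g ⊗[K] g) (c i) ∘ₗ
    TensorProduct.map (A i) (B i)) hsymm

/-- The image of the classical perm Yang–Baxter equation under a linear map. -/
theorem map_permYangBaxter
    (hP : ∑ i, ∑ j,
        (mul (u i) (u j) ⊗ₜ[K] (v j ⊗ₜ[K] v i)
          - u i ⊗ₜ[K] (u j ⊗ₜ[K] mul (v i) (v j))
          + u j ⊗ₜ[K] (mul (u i) (v j) ⊗ₜ[K] v i)
          - u i ⊗ₜ[K] (mul (v i) (u j) ⊗ₜ[K] v j)) = 0)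
    (F : g ⊗[K] (g ⊗[K] g) →ₗ[K] M) :
    ∑ i, ∑ j, F (mul (u i) (u j) ⊗ₜ (v j ⊗ₜ v i))
      + ∑ i, ∑ j, F (u j ⊗ₜ (mul (u i) (v j) ⊗ₜ v i))
      = ∑ i, ∑ j, F (u i ⊗ₜ (u j ⊗ₜ mul (v i) (v j)))
      + ∑ i, ∑ j, F (u i ⊗ₜ (mul (v i) (u j) ⊗ₜ v j)) := by
  have h := congrArg F hP
  simp only [map_sum, map_add, map_sub, map_zero, Finset.sum_add_distrib,
    Finset.sum_sub_distrib] at h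
  rw [← sub_eq_zero, ← h]
  abel

/-- The classical perm Yang–Baxter equation of a symmetric tensor with the last two factors
interchanged. -/
theorem map_permYangBaxter_swap
    (hsymm : ∑ i, v i ⊗ₜ[K] u i = ∑ i, u i ⊗ₜ[K] v i)
    (hP : ∑ i, ∑ j,
        (mul (u i) (u j) ⊗ₜ[K] (v j ⊗ₜ[K] v i)
          - u i ⊗ₜ[K] (u j ⊗ₜ[K] mul (v i) (v j))
          + u j ⊗ₜ[K] (mul (u i) (v j) ⊗ₜ[K] v i)
          - u i ⊗ₜ[K] (mul (v i) (u j) ⊗ₜ[K] v j)) = 0)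
    (F : g ⊗[K] (g ⊗[K] g) →ₗ[K] M) :
    ∑ i, ∑ j, F (mul (u i) (u j) ⊗ₜ (v i ⊗ₜ v j))
      + ∑ i, ∑ j, F (u i ⊗ₜ (u j ⊗ₜ mul (v j) (v i)))
      = ∑ i, ∑ j, F (u i ⊗ₜ (mul (v i) (u j) ⊗ₜ v j))
      + ∑ i, ∑ j, F (u i ⊗ₜ (u j ⊗ₜ mul (v i) (v j))) := by
  have h := map_permYangBaxter hP
    (F ∘ₗ TensorProduct.map LinearMap.id (TensorProduct.comm K g g).toLinearMap)
  simp only [LinearMap.comp_apply, TensorProduct.map_tmul, LinearMap.id_apply,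
    LinearEquiv.coe_coe, TensorProduct.comm_tmul] at h
  have e₁ : ∑ i, ∑ j, F (u j ⊗ₜ (v i ⊗ₜ mul (u i) (v j)))
      = ∑ i, ∑ j, F (u i ⊗ₜ (u j ⊗ₜ mul (v j) (v i))) := by
    rw [Finset.sum_comm]
    exact sum_sum_tmul_symm hsymm F u (fun _ => LinearMap.id) (fun i => mul.flip (v i))
  have e₂ : ∑ i, ∑ j, F (u i ⊗ₜ (v j ⊗ₜ mul (v i) (u j)))
      = ∑ i, ∑ j, F (u i ⊗ₜ (u j ⊗ₜ mul (v i) (v j))) :=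
    sum_sum_tmul_symm hsymm F u (fun _ => LinearMap.id) (fun i => mul (v i))
  have e₃ : ∑ i, ∑ j, F (u i ⊗ₜ (mul (v i) (v j) ⊗ₜ u j))
      = ∑ i, ∑ j, F (u i ⊗ₜ (mul (v i) (u j) ⊗ₜ v j)) :=
    sum_sum_tmul_symm hsymm F u (fun i => mul (v i)) (fun _ => LinearMap.id)
  rw [e₁, e₂, e₃] at h
  exact h

/-- A symmetric solution of the classical perm Yang–Baxter equation gives a perm coalgebra. -/
theorem isPermCoalg_Dmap (hm : IsPerm (fun x y => mul x y))
    (hsymm : ∑ i, v i ⊗ₜ[K] u i = ∑ i, u i ⊗ₜ[K] v i)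
    (hP : ∑ i, ∑ j,
        (mul (u i) (u j) ⊗ₜ[K] (v j ⊗ₜ[K] v i)
          - u i ⊗ₜ[K] (u j ⊗ₜ[K] mul (v i) (v j))
          + u j ⊗ₜ[K] (mul (u i) (v j) ⊗ₜ[K] v i)
          - u i ⊗ₜ[K] (mul (v i) (u j) ⊗ₜ[K] v j)) = 0) :
    IsPermCoalg (Dmap mul u v) := by
  intro x
  have assoc : ∀ a b c, mul (mul a b) c = mul a (mul b c) := fun a b c => (hm a b c).1
  have rcomm : ∀ a b c, mul a (mul b c) = mul a (mul c b) := fun a b c => (hm a b c).2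
  have h₁ := map_permYangBaxter_swap hsymm hP (TensorProduct.map (mul x) LinearMap.id)
  have h₂ := map_permYangBaxter hP (TensorProduct.map (mul x) LinearMap.id)
  have h₃ := map_permYangBaxter hP
    (TensorProduct.map LinearMap.id (TensorProduct.map LinearMap.id (mul x - mul.flip x)))
  simp only [TensorProduct.map_tmul, LinearMap.id_apply, LinearMap.sub_apply,
    LinearMap.flip_apply, TensorProduct.tmul_sub, Finset.sum_sub_distrib, assoc] at h₁ h₂ h₃
  have q₁ : ∑ i, ∑ j, u i ⊗ₜ[K] (u j ⊗ₜ[K] mul (v j) (mul x (v i)))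
      = ∑ i, ∑ j, u i ⊗ₜ[K] (u j ⊗ₜ[K] mul (v j) (mul (v i) x)) := by
    simp only [rcomm _ x]
  have q₀ : ∑ i, ∑ j, mul x (mul (u i) (u j)) ⊗ₜ[K] (v j ⊗ₜ[K] v i)
      = ∑ i, ∑ j, mul x (mul (u i) (u j)) ⊗ₜ[K] (v i ⊗ₜ[K] v j) := by
    rw [Finset.sum_comm]
    simp only [fun i j => rcomm x (u i) (u j)]
  constructor
  · have p₁ : ∑ i, ∑ j, u j ⊗ₜ[K] (mul x (mul (u i) (v j)) ⊗ₜ[K] v i)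
        = ∑ i, ∑ j, u i ⊗ₜ[K] (mul x (mul (v i) (u j)) ⊗ₜ[K] v j) := by
      rw [Finset.sum_comm]
      simp only [fun i j => rcomm x (u i) (v j)]
    have p₂ : ∑ i, ∑ j, u j ⊗ₜ[K] (mul (v j) (mul x (u i)) ⊗ₜ[K] v i)
        = ∑ i, ∑ j, u i ⊗ₜ[K] (mul (v i) (mul x (u j)) ⊗ₜ[K] v j) := Finset.sum_comm
    have p₃ : ∑ i, ∑ j, u j ⊗ₜ[K] (mul (v j) (u i) ⊗ₜ[K] mul x (v i))
        = ∑ i, ∑ j, u i ⊗ₜ[K] (mul (v i) (u j) ⊗ₜ[K] mul x (v j)) := Finset.sum_comm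
    have p₄ : ∑ i, ∑ j, u j ⊗ₜ[K] (mul (v j) (u i) ⊗ₜ[K] mul (v i) x)
        = ∑ i, ∑ j, u i ⊗ₜ[K] (mul (v i) (u j) ⊗ₜ[K] mul (v j) x) := Finset.sum_comm
    have p₅ : ∑ i, ∑ j, u i ⊗ₜ[K] (u j ⊗ₜ[K] mul (v i) (mul x (v j)))
        = ∑ i, ∑ j, u i ⊗ₜ[K] (u j ⊗ₜ[K] mul (v i) (mul (v j) x)) := by
      simp only [rcomm _ x]
    simp only [Dmap_apply, map_sum, map_add, map_sub, TensorProduct.map_tmul,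
      LinearMap.id_apply, TensorProduct.sum_tmul, TensorProduct.tmul_sum,
      TensorProduct.add_tmul, TensorProduct.sub_tmul, TensorProduct.tmul_add,
      TensorProduct.tmul_sub, TensorProduct.assoc_tmul, Finset.sum_add_distrib,
      Finset.sum_sub_distrib, assoc]
    rw [q₀, p₁, p₂, p₃, p₄, p₅, q₁]
    linear_combination (norm := module) h₁ + h₃
  · have p₁ : ∑ i, ∑ j, mul x (u j) ⊗ₜ[K] (mul (u i) (v j) ⊗ₜ[K] v i)
        = ∑ i, ∑ j, mul x (u i) ⊗ₜ[K] (mul (u j) (v i) ⊗ₜ[K] v j) := Finset.sum_comm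
    rw [q₀, p₁] at h₂
    have q₂ : ∑ i, ∑ j, u i ⊗ₜ[K] (mul (v j) (mul x (v i)) ⊗ₜ[K] u j)
        = ∑ i, ∑ j, u i ⊗ₜ[K] (mul (v j) (mul (v i) x) ⊗ₜ[K] u j) := by
      simp only [rcomm _ x]
    have sw := sum_sum_tmul_symm hsymm (LinearMap.id : g ⊗[K] (g ⊗[K] g) →ₗ[K] _)
    have s₁ := sw (fun i => mul x (u i)) (fun _ => LinearMap.id) (fun i => mul (v i))
    have s₂ := sw (fun i => mul x (u i)) (fun i => mul (v i)) (fun _ => LinearMap.id)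
    have s₃ := sw (fun i => mul x (u i)) (fun i => mul.flip (v i)) (fun _ => LinearMap.id)
    have s₄ := sw u (fun i => mul x ∘ₗ mul (v i)) (fun _ => LinearMap.id)
    have s₅ := sw u (fun _ => LinearMap.id) (fun i => mul x ∘ₗ mul (v i))
    have s₆ := sw u (fun i => mul (v i) ∘ₗ mul x) (fun _ => LinearMap.id)
    have s₇ := sw u (fun _ => LinearMap.id) (fun i => mul (v i) ∘ₗ mul x)
    simp only [LinearMap.id_apply, LinearMap.comp_apply, LinearMap.flip_apply]
      at s₁ s₂ s₃ s₄ s₅ s₆ s₇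
    simp only [Dmap_apply, map_sum, map_add, map_sub, TensorProduct.map_tmul,
      LinearMap.id_apply, TensorProduct.tmul_sum, TensorProduct.tmul_add,
      TensorProduct.tmul_sub, TensorProduct.comm_tmul, LinearMap.comp_apply,
      LinearEquiv.coe_coe, Finset.sum_add_distrib, Finset.sum_sub_distrib, assoc]
    rw [q₁, q₂, s₁, s₂, s₃, s₄, s₅, s₆, s₇]
    linear_combination (norm := module) h₂ - h₁

end PermYangBaxter

/-- a symmetric solution of the `S`-admissible perm Yang-Baxter
equation yields a perm coalgebra `(g,Δ_r)` on which `S` is a Nijenhuis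
operator, and the two admissibility identities (c) and (d) hold. -/
theorem stmt13 {K g : Type*} [Field K] [AddCommGroup g] [Module K g]
    {ι : Type*} [Fintype ι]
    (mul : g →ₗ[K] g →ₗ[K] g) (hm : IsPerm (fun x y => mul x y))
    (N S : g →ₗ[K] g) (hN : IsNij (fun x y => mul x y) N)
    (hS : IsAdm (fun x y => mul x y) N S)
    (u v : ι → g)
    (hsymm : ∑ i, v i ⊗ₜ[K] u i = ∑ i, u i ⊗ₜ[K] v i)
    (hP : ∑ i, ∑ j,
        (mul (u i) (u j) ⊗ₜ[K] (v j ⊗ₜ[K] v i)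
          - u i ⊗ₜ[K] (u j ⊗ₜ[K] mul (v i) (v j))
          + u j ⊗ₜ[K] (mul (u i) (v j) ⊗ₜ[K] v i)
          - u i ⊗ₜ[K] (mul (v i) (u j) ⊗ₜ[K] v j)) = 0)
    (hadm : ∑ i, S (u i) ⊗ₜ[K] v i = ∑ i, u i ⊗ₜ[K] N (v i)) :
    IsPermCoalg (Dmap mul u v) ∧
    (∀ x : g,
      TensorProduct.map S S (Dmap mul u v x) + Dmap mul u v (S (S x))
        = TensorProduct.map S LinearMap.id (Dmap mul u v (S x))
          + TensorProduct.map LinearMap.id S (Dmap mul u v (S x))) ∧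
    (∀ x : g,
      TensorProduct.map S LinearMap.id (Dmap mul u v (N x))
          + TensorProduct.map LinearMap.id (N ∘ₗ N) (Dmap mul u v x)
        = TensorProduct.map S N (Dmap mul u v x)
          + TensorProduct.map LinearMap.id N (Dmap mul u v (N x))) ∧
    (∀ x : g,
      TensorProduct.map LinearMap.id S (Dmap mul u v (N x))
          + TensorProduct.map (N ∘ₗ N) LinearMap.id (Dmap mul u v x)
        = TensorProduct.map N S (Dmap mul u v x)
          + TensorProduct.map N LinearMap.id (Dmap mul u v (N x))) := by
  have swap (A B : g →ₗ[K] g) : ∑ i, A (v i) ⊗ₜ[K] B (u i) = ∑ i, A (u i) ⊗ₜ[K] B (v i) := by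
    simpa using congrArg (TensorProduct.map A B) hsymm
  have left (A B : g →ₗ[K] g) :
      ∑ i, A (u i) ⊗ₜ[K] B (N (v i)) = ∑ i, A (S (u i)) ⊗ₜ[K] B (v i) := by
    simpa using congrArg (TensorProduct.map A B) hadm.symm
  have right (A B : g →ₗ[K] g) :
      ∑ i, A (u i) ⊗ₜ[K] B (S (v i)) = ∑ i, A (N (u i)) ⊗ₜ[K] B (v i) := by
    have h := congrArg (TensorProduct.map A B ∘ₗ (TensorProduct.comm K g g).toLinearMap) hadm
    simp only [LinearMap.comp_apply, LinearEquiv.coe_coe, map_sum, TensorProduct.comm_tmul,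
      TensorProduct.map_tmul] at h
    exact ((swap A (B ∘ₗ S)).symm.trans h).trans (swap (A ∘ₗ N) B)
  refine ⟨isPermCoalg_Dmap hm hsymm hP, fun x => ?_, fun x => ?_, fun x => ?_⟩
  · have e₁ := right (S ∘ₗ mul x) LinearMap.id
    have e₂ := right (mul (S x)) LinearMap.id
    have e₃ := left LinearMap.id (S ∘ₗ mul x)
    have e₄ := left LinearMap.id (S ∘ₗ mul.flip x)
    have e₅ := left LinearMap.id (mul (S x))
    have e₆ := left LinearMap.id (mul.flip (S x))
    simp only [LinearMap.id_apply, LinearMap.comp_apply, LinearMap.flip_apply]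
      at e₁ e₂ e₃ e₄ e₅ e₆
    simp only [Dmap_apply, map_sum, map_add, map_sub, TensorProduct.map_tmul,
      LinearMap.id_apply, Finset.sum_add_distrib,
      Finset.sum_sub_distrib, e₁, e₂, ← e₃, ← e₄, ← e₅, ← e₆]
    simp only [← Finset.sum_add_distrib, ← Finset.sum_sub_distrib]
    refine Finset.sum_congr rfl fun i _ => ?_
    have a₁ := congrArg (· ⊗ₜ[K] v i) (hS x (u i)).2
    have a₂ := congrArg (u i ⊗ₜ[K] ·) (hS x (v i)).2
    have a₃ := congrArg (u i ⊗ₜ[K] ·) (hS (v i) x).1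
    simp only [TensorProduct.add_tmul, TensorProduct.tmul_add] at a₁ a₂ a₃
    linear_combination (norm := module) a₁ + a₂ - a₃
  · have e₁ := left (mul x) N
    have e₂ := left (mul x ∘ₗ S) LinearMap.id
    have e₃ := left (S ∘ₗ mul x) LinearMap.id
    have e₄ := left (mul (N x)) LinearMap.id
    have e₅ := left LinearMap.id (mul (N x))
    have e₆ := left LinearMap.id (mul.flip (N x))
    have e₇ := left LinearMap.id (N ∘ₗ mul x)
    have e₈ := left LinearMap.id (N ∘ₗ mul.flip x)
    simp only [LinearMap.id_apply, LinearMap.comp_apply, LinearMap.flip_apply]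
      at e₁ e₂ e₃ e₄ e₅ e₆ e₇ e₈
    simp only [Dmap_apply, map_sum, map_add, map_sub, TensorProduct.map_tmul,
      LinearMap.id_apply, LinearMap.comp_apply, Finset.sum_add_distrib,
      Finset.sum_sub_distrib, e₁, e₂, e₃, e₄, ← e₅, ← e₆, ← e₇, ← e₈]
    simp only [← Finset.sum_add_distrib, ← Finset.sum_sub_distrib]
    refine Finset.sum_congr rfl fun i _ => ?_
    have a₁ := congrArg (· ⊗ₜ[K] v i) (hS x (u i)).1
    have a₂ := congrArg (u i ⊗ₜ[K] ·) (hN x (v i))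
    have a₃ := congrArg (u i ⊗ₜ[K] ·) (hN (v i) x)
    simp only [TensorProduct.add_tmul, TensorProduct.tmul_add] at a₁ a₂ a₃
    linear_combination (norm := module) a₁ + a₂ - a₃
  · have e₁ := right (mul (N x)) LinearMap.id
    have e₂ := right (N ∘ₗ mul x) LinearMap.id
    have e₃ := right N (mul x)
    have e₄ := right N (mul.flip x)
    have e₅ := right LinearMap.id (mul x ∘ₗ S)
    have e₆ := right LinearMap.id (mul.flip x ∘ₗ S)
    have e₇ := right LinearMap.id (S ∘ₗ mul x)
    have e₈ := right LinearMap.id (S ∘ₗ mul.flip x)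
    have e₉ := right LinearMap.id (mul (N x))
    have e₁₀ := right LinearMap.id (mul.flip (N x))
    simp only [LinearMap.id_apply, LinearMap.comp_apply, LinearMap.flip_apply]
      at e₁ e₂ e₃ e₄ e₅ e₆ e₇ e₈ e₉ e₁₀
    simp only [Dmap_apply, map_sum, map_add, map_sub, TensorProduct.map_tmul,
      LinearMap.id_apply, LinearMap.comp_apply, Finset.sum_add_distrib,
      Finset.sum_sub_distrib, e₁, e₂, ← e₃, ← e₄, ← e₅, ← e₆, ← e₇, ← e₈, ← e₉, ← e₁₀]
    simp only [← Finset.sum_add_distrib, ← Finset.sum_sub_distrib]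
    refine Finset.sum_congr rfl fun i _ => ?_
    have a₁ := congrArg (· ⊗ₜ[K] v i) (hN x (u i))
    have a₂ := congrArg (u i ⊗ₜ[K] ·) (hS x (v i)).1
    have a₃ := congrArg (u i ⊗ₜ[K] ·) (hS (v i) x).2
    simp only [TensorProduct.add_tmul, TensorProduct.tmul_add] at a₁ a₂ a₃
    linear_combination (norm := module) a₁ + a₂ - a₃
end

section
/- Let (g,N) be a Nijenhuis perm algebra, S : g → g a linear map, and r = Σᵢ uᵢ⊗vᵢ ∈ g⊗g symmetric (τ(r) = r). Define r♯ : g* → g by r♯(ξ) = Σᵢ ξ(uᵢ) vᵢ. Then r satisfies P(r) = 0 together with (S⊗id)(r) = (id⊗N)(r) if and only if: (i) for all ξ, η ∈ g*, r♯(ξ)·r♯(η) = r♯( z ↦ η(z·r♯(ξ)) − η(r♯(ξ)·z) + ξ(z·r♯(η)) ), and (ii) N ∘ r♯ = r♯ ∘ S*, where S* : g* → g* is the dual map S*(ξ) = ξ ∘ S. -/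
open TensorProduct

/-- Contraction of the left tensor factor with a linear form. -/
noncomputable def contractDual {K V : Type*} (W : Type*) [CommRing K] [AddCommGroup V] [Module K V]
    [AddCommGroup W] [Module K W] (ξ : Module.Dual K V) : V ⊗[K] W →ₗ[K] W :=
  (TensorProduct.lid K W).toLinearMap ∘ₗ LinearMap.rTensor W ξ

@[simp]
theorem contractDual_tmul {K V W : Type*} [CommRing K] [AddCommGroup V] [Module K V]
    [AddCommGroup W] [Module K W] (ξ : Module.Dual K V) (x : V) (w : W) :
    contractDual W ξ (x ⊗ₜ[K] w) = ξ x • w := by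
  simp [contractDual]

/-- Contractions with linear forms separate the points of `V ⊗ W` when `V` is free. -/
theorem eq_iff_forall_contractDual_eq {K V W : Type*} [CommRing K] [AddCommGroup V] [Module K V]
    [Module.Free K V] [AddCommGroup W] [Module K W] {s t : V ⊗[K] W} :
    s = t ↔ ∀ ξ : Module.Dual K V, contractDual W ξ s = contractDual W ξ t := by
  refine ⟨fun h ξ => by rw [h], fun h => ?_⟩
  let b := Module.Free.chooseBasis K V
  apply (TensorProduct.equivFinsuppOfBasisLeft (N := W) b).injective
  ext i
  simpa [contractDual, TensorProduct.equivFinsuppOfBasisLeft_apply] using h (b.coord i)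

/-- for a Nijenhuis perm algebra `(g,N)`, a linear map `S` and
symmetric `r = Σᵢ uᵢ⊗vᵢ`, `r` solves the `S`-admissible perm Yang-Baxter
equation iff `r♯` satisfies the O-operator identity and `N ∘ r♯ = r♯ ∘ S*`. -/
theorem stmt14 {K g : Type*} [Field K] [AddCommGroup g] [Module K g]
    {ι : Type*} [Fintype ι]
    (mul : g →ₗ[K] g →ₗ[K] g) (hm : IsPerm (fun x y => mul x y))
    (N : g →ₗ[K] g) (hN : IsNij (fun x y => mul x y) N)
    (S : g →ₗ[K] g) (u v : ι → g)
    (hsymm : ∑ i, v i ⊗ₜ[K] u i = ∑ i, u i ⊗ₜ[K] v i)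
    (rs : Module.Dual K g → g)
    (hrs : ∀ ξ : Module.Dual K g, rs ξ = ∑ i, ξ (u i) • v i) :
    ((∑ i, ∑ j,
        (mul (u i) (u j) ⊗ₜ[K] (v j ⊗ₜ[K] v i)
          - u i ⊗ₜ[K] (u j ⊗ₜ[K] mul (v i) (v j))
          + u j ⊗ₜ[K] (mul (u i) (v j) ⊗ₜ[K] v i)
          - u i ⊗ₜ[K] (mul (v i) (u j) ⊗ₜ[K] v j)) = (0 : g ⊗[K] (g ⊗[K] g))) ∧
      (∑ i, S (u i) ⊗ₜ[K] v i = ∑ i, u i ⊗ₜ[K] N (v i))) ↔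
    ((∀ ξ η : Module.Dual K g,
        mul (rs ξ) (rs η)
          = rs (η ∘ₗ mul.flip (rs ξ) - η ∘ₗ mul (rs ξ) + ξ ∘ₗ mul.flip (rs η))) ∧
      (∀ ξ : Module.Dual K g, N (rs ξ) = rs (ξ ∘ₗ S))) := by
  have hrs' : ∀ ξ : Module.Dual K g, rs ξ = ∑ i, ξ (v i) • u i := fun ξ => by
    have h := congrArg (contractDual g ξ) hsymm
    simp only [map_sum, contractDual_tmul] at h
    rw [hrs, h]
  refine and_congr ?_ ?_
  · rw [eq_iff_forall_contractDual_eq]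
    refine forall_congr' fun ξ => ?_
    rw [eq_iff_forall_contractDual_eq]
    refine forall_congr' fun η => ?_
    have h₁ : ∑ i, ∑ j, ξ (mul (u i) (u j)) • η (v j) • v i = rs (ξ ∘ₗ mul.flip (rs η)) := by
      simp [hrs (ξ ∘ₗ _), hrs' η, Finset.sum_smul, smul_smul, mul_comm]
    have h₂ : ∑ i, ∑ j, ξ (u i) • η (u j) • mul (v i) (v j) = mul (rs ξ) (rs η) := by
      simp_rw [smul_comm (ξ _)]
      rw [Finset.sum_comm]
      simp [hrs, Finset.smul_sum]
    have h₃ : ∑ i, ∑ j, ξ (u j) • η (mul (u i) (v j)) • v i = rs (η ∘ₗ mul.flip (rs ξ)) := by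
      simp [hrs (η ∘ₗ _), hrs ξ, Finset.sum_smul, smul_smul]
    have h₄ : ∑ i, ∑ j, ξ (u i) • η (mul (v i) (u j)) • v j = rs (η ∘ₗ mul (rs ξ)) := by
      rw [Finset.sum_comm]
      simp [hrs (η ∘ₗ _), hrs ξ, Finset.sum_smul, smul_smul]
    have hadd : rs (η ∘ₗ mul.flip (rs ξ) - η ∘ₗ mul (rs ξ) + ξ ∘ₗ mul.flip (rs η)) =
        rs (η ∘ₗ mul.flip (rs ξ)) - rs (η ∘ₗ mul (rs ξ)) + rs (ξ ∘ₗ mul.flip (rs η)) := by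
      simp only [hrs (_ + _), hrs (_ ∘ₗ _), LinearMap.add_apply, LinearMap.sub_apply, add_smul,
        sub_smul, Finset.sum_add_distrib, Finset.sum_sub_distrib]
    simp only [map_sum, map_add, map_sub, map_smul, map_zero, contractDual_tmul,
      Finset.sum_add_distrib, Finset.sum_sub_distrib, h₁, h₂, h₃, h₄, hadd]
    rw [eq_comm (a := mul _ _), ← sub_eq_zero (b := mul _ _)]
    exact Eq.congr_left (by abel)
  · rw [eq_iff_forall_contractDual_eq]
    refine forall_congr' fun ξ => ?_
    simp only [map_sum, contractDual_tmul, hrs, map_smul, LinearMap.comp_apply]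
    exact eq_comm
end

section
/- Let (g,Δ) be a perm coalgebra and ω a symmetric bilinear form on g (ω(x,y) = ω(y,x)) satisfying the classical co-perm Yang–Baxter equation in (g,Δ). Define the multiplication x ·_ω y = x₍₁₎ ω(x₍₂₎,y) + y₍₁₎ ω(x,y₍₂₎) − y₍₂₎ ω(x,y₍₁₎) (Sweedler notation with implicit sums). Then (g, ·_ω, ω) is a symplectic perm algebra; in particular ω(x ·_ω y, z) + ω(x ·_ω z, y) = ω(z ·_ω x, y) + ω(z ·_ω y, x) for all x,y,z ∈ g. -/
open TensorProduct

/-- Right contraction `a ⊗ b ↦ φ(b) • a`. -/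
noncomputable def ctrR {K g : Type*} [Field K] [AddCommGroup g] [Module K g]
    (φ : g →ₗ[K] K) : g ⊗[K] g →ₗ[K] g :=
  (TensorProduct.rid K g).toLinearMap ∘ₗ TensorProduct.map LinearMap.id φ

/-- Left contraction `a ⊗ b ↦ φ(a) • b`. -/
noncomputable def ctrL {K g : Type*} [Field K] [AddCommGroup g] [Module K g]
    (φ : g →ₗ[K] K) : g ⊗[K] g →ₗ[K] g :=
  (TensorProduct.lid K g).toLinearMap ∘ₗ TensorProduct.map φ LinearMap.id

/-- The pairing `a ⊗ b ↦ φ(a)·ψ(b)`. -/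
noncomputable def dpair {K g : Type*} [Field K] [AddCommGroup g] [Module K g]
    (φ ψ : g →ₗ[K] K) : g ⊗[K] g →ₗ[K] K :=
  (TensorProduct.lid K K).toLinearMap ∘ₗ TensorProduct.map φ ψ

/-- The multiplication `x ·_ω y = x₍₁₎ω(x₍₂₎,y) + y₍₁₎ω(x,y₍₂₎) − y₍₂₎ω(x,y₍₁₎)`. -/
noncomputable def mulOmega {K g : Type*} [Field K] [AddCommGroup g] [Module K g]
    (Δ : g →ₗ[K] g ⊗[K] g) (ω : g →ₗ[K] g →ₗ[K] K) (x y : g) : g :=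
  ctrR (ω.flip y) (Δ x) + ctrR (ω x) (Δ y) - ctrL (ω x) (Δ y)

/-- The classical co-perm Yang-Baxter equation. -/
def CoYBE {K g : Type*} [Field K] [AddCommGroup g] [Module K g]
    (Δ : g →ₗ[K] g ⊗[K] g) (ω : g →ₗ[K] g →ₗ[K] K) : Prop :=
  ∀ x y z : g,
    dpair (ω.flip z) (ω.flip y) (Δ x) - dpair (ω x) (ω y) (Δ z)
      + dpair (ω.flip z) (ω x) (Δ y) - dpair (ω x) (ω.flip z) (Δ y) = 0

section PermCoalgebra

variable {K g : Type*} [Field K] [AddCommGroup g] [Module K g]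

@[simp] lemma ctrR_tmul (φ : g →ₗ[K] K) (a b : g) : ctrR φ (a ⊗ₜ[K] b) = φ b • a := by
  simp [ctrR]

@[simp] lemma ctrL_tmul (φ : g →ₗ[K] K) (a b : g) : ctrL φ (a ⊗ₜ[K] b) = φ a • b := by
  simp [ctrL]

@[simp] lemma dpair_tmul (φ ψ : g →ₗ[K] K) (a b : g) :
    dpair φ ψ (a ⊗ₜ[K] b) = φ a * ψ b := by
  simp [dpair]

lemma apply_ctrR (φ ψ : g →ₗ[K] K) (t : g ⊗[K] g) : φ (ctrR ψ t) = dpair φ ψ t := by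
  induction t with
  | zero => simp
  | tmul a b => simp [mul_comm]
  | add s t hs ht => simp [hs, ht]

lemma apply_ctrL (φ ψ : g →ₗ[K] K) (t : g ⊗[K] g) : φ (ctrL ψ t) = dpair ψ φ t := by
  induction t with
  | zero => simp
  | tmul a b => simp
  | add s t hs ht => simp [hs, ht]

lemma dpair_comm (φ ψ : g →ₗ[K] K) (t : g ⊗[K] g) :
    dpair φ ψ (TensorProduct.comm K g g t) = dpair ψ φ t := by
  induction t with
  | zero => simp
  | tmul a b => simp [mul_comm]
  | add s t hs ht => simp [hs, ht]

lemma ctrL_comm (φ : g →ₗ[K] K) (t : g ⊗[K] g) :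
    ctrL φ (TensorProduct.comm K g g t) = ctrR φ t := by
  induction t with
  | zero => simp
  | tmul a b => simp
  | add s t hs ht => simp [hs, ht]

/-- The contraction `a ⊗ b ⊗ c ↦ φ(b)ψ(c) • a`. -/
noncomputable def keepFst (φ ψ : g →ₗ[K] K) : g ⊗[K] (g ⊗[K] g) →ₗ[K] g :=
  (TensorProduct.rid K g).toLinearMap ∘ₗ TensorProduct.map LinearMap.id (dpair φ ψ)

/-- The contraction `a ⊗ b ⊗ c ↦ φ(a)ψ(c) • b`. -/
noncomputable def keepSnd (φ ψ : g →ₗ[K] K) : g ⊗[K] (g ⊗[K] g) →ₗ[K] g :=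
  (TensorProduct.lid K g).toLinearMap ∘ₗ TensorProduct.map φ (ctrR ψ)

/-- The contraction `a ⊗ b ⊗ c ↦ φ(a)ψ(b) • c`. -/
noncomputable def keepTrd (φ ψ : g →ₗ[K] K) : g ⊗[K] (g ⊗[K] g) →ₗ[K] g :=
  (TensorProduct.lid K g).toLinearMap ∘ₗ TensorProduct.map φ (ctrL ψ)

@[simp] lemma keepFst_tmul (φ ψ : g →ₗ[K] K) (a : g) (t : g ⊗[K] g) :
    keepFst φ ψ (a ⊗ₜ[K] t) = dpair φ ψ t • a := by
  simp [keepFst]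

@[simp] lemma keepSnd_tmul (φ ψ : g →ₗ[K] K) (a : g) (t : g ⊗[K] g) :
    keepSnd φ ψ (a ⊗ₜ[K] t) = φ a • ctrR ψ t := by
  simp [keepSnd]

@[simp] lemma keepTrd_tmul (φ ψ : g →ₗ[K] K) (a : g) (t : g ⊗[K] g) :
    keepTrd φ ψ (a ⊗ₜ[K] t) = φ a • ctrL ψ t := by
  simp [keepTrd]

lemma keepFst_assoc_tmul (φ ψ : g →ₗ[K] K) (t : g ⊗[K] g) (c : g) :
    keepFst φ ψ (TensorProduct.assoc K g g g (t ⊗ₜ[K] c)) = ψ c • ctrR φ t := by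
  induction t with
  | zero => simp
  | tmul a b => simp [mul_smul, smul_comm (φ b)]
  | add s t hs ht => simp [TensorProduct.add_tmul, hs, ht]

lemma keepSnd_assoc_tmul (φ ψ : g →ₗ[K] K) (t : g ⊗[K] g) (c : g) :
    keepSnd φ ψ (TensorProduct.assoc K g g g (t ⊗ₜ[K] c)) = ψ c • ctrL φ t := by
  induction t with
  | zero => simp
  | tmul a b => simp [smul_comm (φ a)]
  | add s t hs ht => simp [TensorProduct.add_tmul, hs, ht]

lemma keepTrd_assoc_tmul (φ ψ : g →ₗ[K] K) (t : g ⊗[K] g) (c : g) :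
    keepTrd φ ψ (TensorProduct.assoc K g g g (t ⊗ₜ[K] c)) = dpair φ ψ t • c := by
  induction t with
  | zero => simp
  | tmul a b => simp [mul_smul]
  | add s t hs ht => simp [TensorProduct.add_tmul, hs, ht, add_smul]

variable (Δ : g →ₗ[K] g ⊗[K] g) (φ ψ : g →ₗ[K] K)

lemma ctrR_ctrR (t : g ⊗[K] g) :
    ctrR φ (Δ (ctrR ψ t)) =
      keepFst φ ψ (TensorProduct.assoc K g g g (TensorProduct.map Δ LinearMap.id t)) := by
  induction t with
  | zero => simp
  | tmul a b => simp [keepFst_assoc_tmul]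
  | add s t hs ht => simp [hs, ht]

lemma ctrL_ctrR (t : g ⊗[K] g) :
    ctrL φ (Δ (ctrR ψ t)) =
      keepSnd φ ψ (TensorProduct.assoc K g g g (TensorProduct.map Δ LinearMap.id t)) := by
  induction t with
  | zero => simp
  | tmul a b => simp [keepSnd_assoc_tmul]
  | add s t hs ht => simp [hs, ht]

lemma ctrL_dpair_comp (t : g ⊗[K] g) :
    ctrL (dpair φ ψ ∘ₗ Δ) t =
      keepTrd φ ψ (TensorProduct.assoc K g g g (TensorProduct.map Δ LinearMap.id t)) := by
  induction t with
  | zero => simp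
  | tmul a b => simp [keepTrd_assoc_tmul]
  | add s t hs ht => simp [hs, ht]

lemma ctrR_dpair_comp (t : g ⊗[K] g) :
    ctrR (dpair φ ψ ∘ₗ Δ) t = keepFst φ ψ (TensorProduct.map LinearMap.id Δ t) := by
  induction t with
  | zero => simp
  | tmul a b => simp
  | add s t hs ht => simp [hs, ht]

lemma ctrR_ctrL (t : g ⊗[K] g) :
    ctrR ψ (Δ (ctrL φ t)) = keepSnd φ ψ (TensorProduct.map LinearMap.id Δ t) := by
  induction t with
  | zero => simp
  | tmul a b => simp
  | add s t hs ht => simp [hs, ht]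

lemma ctrL_ctrL (t : g ⊗[K] g) :
    ctrL ψ (Δ (ctrL φ t)) = keepTrd φ ψ (TensorProduct.map LinearMap.id Δ t) := by
  induction t with
  | zero => simp
  | tmul a b => simp
  | add s t hs ht => simp [hs, ht]

lemma keepFst_map_comm (t : g ⊗[K] g) :
    keepFst φ ψ (TensorProduct.map LinearMap.id
        ((TensorProduct.comm K g g).toLinearMap ∘ₗ Δ) t) =
      keepFst ψ φ (TensorProduct.map LinearMap.id Δ t) := by
  induction t with
  | zero => simp
  | tmul a b => simp [dpair_comm]
  | add s t hs ht => simp only [map_add, hs, ht]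

lemma keepTrd_map_comm (t : g ⊗[K] g) :
    keepTrd φ ψ (TensorProduct.map LinearMap.id
        ((TensorProduct.comm K g g).toLinearMap ∘ₗ Δ) t) =
      keepSnd φ ψ (TensorProduct.map LinearMap.id Δ t) := by
  induction t with
  | zero => simp
  | tmul a b => simp [ctrL_comm]
  | add s t hs ht => simp only [map_add, hs, ht]

variable {Δ}

lemma IsPermCoalg.ctrR_dpair (hΔ : IsPermCoalg Δ) (x : g) :
    ctrR (dpair φ ψ ∘ₗ Δ) (Δ x) = ctrR φ (Δ (ctrR ψ (Δ x))) := by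
  rw [ctrR_dpair_comp, ctrR_ctrR, (hΔ x).1]

lemma IsPermCoalg.ctrR_ctrR_comm (hΔ : IsPermCoalg Δ) (x : g) :
    ctrR φ (Δ (ctrR ψ (Δ x))) = ctrR ψ (Δ (ctrR φ (Δ x))) := by
  rw [ctrR_ctrR, ctrR_ctrR, (hΔ x).1, ← keepFst_map_comm, ← (hΔ x).2]

lemma IsPermCoalg.ctrL_dpair (hΔ : IsPermCoalg Δ) (x : g) :
    ctrL (dpair φ ψ ∘ₗ Δ) (Δ x) = ctrL ψ (Δ (ctrL φ (Δ x))) := by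
  rw [ctrL_dpair_comp, ctrL_ctrL, (hΔ x).1]

lemma IsPermCoalg.ctrL_ctrR_eq (hΔ : IsPermCoalg Δ) (x : g) :
    ctrL φ (Δ (ctrR ψ (Δ x))) = ctrL ψ (Δ (ctrL φ (Δ x))) := by
  rw [ctrL_ctrR, ctrL_ctrL, (hΔ x).1, ← keepTrd_map_comm, ← (hΔ x).2]

lemma IsPermCoalg.ctrR_ctrL_eq (hΔ : IsPermCoalg Δ) (x : g) :
    ctrR ψ (Δ (ctrL φ (Δ x))) = ctrL ψ (Δ (ctrL φ (Δ x))) := by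
  rw [ctrR_ctrL, ctrL_ctrL, ← keepTrd_map_comm, ← (hΔ x).2]

/-- For symmetric `ω`, the co-perm Yang-Baxter equation says
`ω(x ·_ω y, z) = ω(x,z₍₁₎)ω(y,z₍₂₎)`. -/
lemma CoYBE.apply_mulOmega {ω : g →ₗ[K] g →ₗ[K] K} (hybe : CoYBE Δ ω)
    (hflip : ω.flip = ω) (x y : g) :
    ω (mulOmega Δ ω x y) = dpair (ω x) (ω y) ∘ₗ Δ := by
  ext z
  have h := hybe x y z
  have hz (w : g) : ω w z = ω z w := LinearMap.congr_fun₂ hflip z w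
  simp only [hflip] at h
  rw [hz]
  simp only [mulOmega, hflip, map_add, map_sub, apply_ctrR, apply_ctrL,
    LinearMap.comp_apply]
  linear_combination h

end PermCoalgebra

/-- if `ω` is a symmetric solution of the classical co-perm
Yang-Baxter equation in the perm coalgebra `(g,Δ)`, then `(g, ·_ω, ω)` is a
symplectic perm algebra. -/
theorem stmt17 {K g : Type*} [Field K] [AddCommGroup g] [Module K g]
    (Δ : g →ₗ[K] g ⊗[K] g) (hΔ : IsPermCoalg Δ)
    (ω : g →ₗ[K] g →ₗ[K] K) (hsym : ∀ x y : g, ω x y = ω y x)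
    (hybe : CoYBE Δ ω) :
    IsPerm (mulOmega Δ ω) ∧
    ∀ x y z : g,
      ω (mulOmega Δ ω x y) z + ω (mulOmega Δ ω x z) y
        = ω (mulOmega Δ ω z x) y + ω (mulOmega Δ ω z y) x := by
  have hflip : ω.flip = ω := LinearMap.ext₂ fun x y => hsym y x
  have key := hybe.apply_mulOmega hflip
  have hmul (x y : g) :
      mulOmega Δ ω x y = ctrR (ω y) (Δ x) + ctrR (ω x) (Δ y) - ctrL (ω x) (Δ y) := by
    rw [mulOmega, hflip]
  have hleft (x y z : g) : mulOmega Δ ω (mulOmega Δ ω x y) z =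
      ctrR (ω z) (Δ (mulOmega Δ ω x y)) + ctrR (ω x) (Δ (ctrR (ω y) (Δ z)))
        - ctrL (ω y) (Δ (ctrL (ω x) (Δ z))) := by
    rw [hmul (mulOmega Δ ω x y) z, key, hΔ.ctrR_dpair, hΔ.ctrL_dpair]
  have hright (x y z : g) : mulOmega Δ ω x (mulOmega Δ ω y z) =
      ctrR (ω y) (Δ (ctrR (ω z) (Δ x))) + ctrR (ω x) (Δ (mulOmega Δ ω y z))
        - ctrL (ω x) (Δ (mulOmega Δ ω y z)) := by
    rw [hmul x (mulOmega Δ ω y z), key, hΔ.ctrR_dpair]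
  refine ⟨fun x y z => ⟨?_, ?_⟩, fun x y z => ?_⟩
  · rw [hleft, hright, hmul x y, hmul y z]
    simp only [map_add, map_sub, hΔ.ctrL_ctrR_eq, hΔ.ctrR_ctrL_eq]
    rw [hΔ.ctrR_ctrR_comm (ω z) (ω y) x, hΔ.ctrR_ctrR_comm (ω z) (ω x) y]
    abel
  · rw [hright, hright, hmul y z, hmul z y]
    simp only [map_add, map_sub, hΔ.ctrL_ctrR_eq, hΔ.ctrR_ctrL_eq]
    rw [hΔ.ctrR_ctrR_comm (ω y) (ω z) x]
    abel
  · have h := hybe x y z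
    simp only [hflip] at h
    simp only [key, LinearMap.comp_apply]
    linear_combination -h
end

section
/- Let (g,·,ω) be a symplectic perm algebra, and let r = Σᵢ uᵢ⊗vᵢ ∈ g⊗g be symmetric (τ(r) = r) and satisfy the classical perm Yang–Baxter equation P(r) = 0 in (g,·). Suppose further that ω satisfies the classical co-perm Yang–Baxter equation with respect to the comultiplication Δ_r, where Δ_r(x) = Σᵢ (x·uᵢ ⊗ vᵢ + uᵢ ⊗ x·vᵢ − uᵢ ⊗ vᵢ·x). Then the linear map N : g → g defined by N(x) = Σᵢ ω(x, uᵢ) vᵢ is a Nijenhuis operator on the perm algebra (g,·), i.e. N(x)·N(y) + N²(x·y) = N(N(x)·y) + N(x·N(y)) for all x,y ∈ g. -/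
open TensorProduct

/-- The map `x ↦ Σᵢ ω(x,uᵢ) vᵢ` as a linear map. -/
noncomputable def sharp {K g : Type*} [Field K] [AddCommGroup g] [Module K g]
    {ι : Type*} [Fintype ι] (ω : g →ₗ[K] g →ₗ[K] K) (u v : ι → g) : g →ₗ[K] g :=
  ∑ i, (ω.flip (u i)).smulRight (v i)

section

variable {K g : Type*} [Field K] [AddCommGroup g] [Module K g] {ι : Type*} [Fintype ι]
  (mul : g →ₗ[K] g →ₗ[K] g) (ω : g →ₗ[K] g →ₗ[K] K) (u v : ι → g)

theorem sharp_apply (x : g) : sharp ω u v x = ∑ i, ω x (u i) • v i := by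
  simp [sharp]

theorem map_sharp {M : Type*} [AddCommGroup M] [Module K M] (f : g →ₗ[K] M) (x : g) :
    f (sharp ω u v x) = ∑ i, ω x (u i) • f (v i) := by
  simp [sharp_apply]

variable {u v}

theorem map_sharp_of_symm (hsymm : ∑ i, v i ⊗ₜ[K] u i = ∑ i, u i ⊗ₜ[K] v i)
    {M : Type*} [AddCommGroup M] [Module K M] (f : g →ₗ[K] M) (x : g) :
    f (sharp ω u v x) = ∑ i, ω x (v i) • f (u i) := by
  rw [map_sharp]
  simpa using congrArg (TensorProduct.lift ((LinearMap.lsmul K M).compl₁₂ (ω x) f)) hsymm.symm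

variable {ω}

theorem form_sharp_comm (hsym : ∀ x y : g, ω x y = ω y x)
    (hsymm : ∑ i, v i ⊗ₜ[K] u i = ∑ i, u i ⊗ₜ[K] v i) (x y : g) :
    ω (sharp ω u v x) y = ω x (sharp ω u v y) := by
  rw [hsym, map_sharp, map_sharp_of_symm ω hsymm]
  refine Finset.sum_congr rfl fun i _ => ?_
  simp only [smul_eq_mul, mul_comm]

variable {mul}

/-- Right multiplication by `y` commutes with `N` up to an `ω`-self-adjoint operator. -/
theorem form_defect_comm (hsym : ∀ x y : g, ω x y = ω y x)
    (hsymp : ∀ x y z : g,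
      ω (mul x y) z + ω (mul x z) y = ω (mul z x) y + ω (mul z y) x)
    (hsymm : ∑ i, v i ⊗ₜ[K] u i = ∑ i, u i ⊗ₜ[K] v i)
    (hybe : CoYBE (Dmap mul u v) ω) (x y z : g) :
    ω (mul x (sharp ω u v y) - sharp ω u v (mul x y)) z
      = ω (mul z (sharp ω u v y) - sharp ω u v (mul z y)) x := by
  have pair (a b c : g) : dpair (ω a) (ω b) (Dmap mul u v c)
      = ω b (mul c (sharp ω u v a)) + ω a (mul c (sharp ω u v b))
        - ω b (mul (sharp ω u v a) c) := by
    have h₁ := map_sharp ω u v (ω b ∘ₗ mul c) a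
    have h₂ := map_sharp_of_symm ω hsymm (ω a ∘ₗ mul c) b
    have h₃ := map_sharp ω u v (ω b ∘ₗ mul.flip c) a
    simp only [LinearMap.comp_apply, LinearMap.flip_apply, smul_eq_mul] at h₁ h₂ h₃
    rw [h₁, h₂, h₃, ← Finset.sum_add_distrib, ← Finset.sum_sub_distrib]
    simp only [Dmap, dpair, LinearMap.sum_apply, map_sum]
    refine Finset.sum_congr rfl fun i _ => ?_
    simp
    ring
  have hflip : ω.flip = ω := LinearMap.ext₂ fun a b => hsym b a
  have h := hybe x y z
  simp only [hflip, pair, hsym _ (mul _ _)] at h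
  simp only [map_sub, LinearMap.sub_apply, form_sharp_comm hsym hsymm]
  linear_combination h - hsymp x y (sharp ω u v z) + hsymp z y (sharp ω u v x)

/-- The classical perm Yang–Baxter equation in operator form. -/
theorem mul_sharp_sharp (hsymm : ∑ i, v i ⊗ₜ[K] u i = ∑ i, u i ⊗ₜ[K] v i)
    (hP : ∑ i, ∑ j,
        (mul (u i) (u j) ⊗ₜ[K] (v j ⊗ₜ[K] v i)
          - u i ⊗ₜ[K] (u j ⊗ₜ[K] mul (v i) (v j))
          + u j ⊗ₜ[K] (mul (u i) (v j) ⊗ₜ[K] v i)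
          - u i ⊗ₜ[K] (mul (v i) (u j) ⊗ₜ[K] v j)) = (0 : g ⊗[K] (g ⊗[K] g)))
    (x y : g) :
    mul (sharp ω u v x) (sharp ω u v y)
      = ∑ i, (ω x (mul (u i) (sharp ω u v y)) + ω y (mul (u i) (sharp ω u v x))
          - ω y (mul (sharp ω u v x) (u i))) • v i := by
  have h := congrArg (TensorProduct.lift ((LinearMap.lsmul K g).compl₁₂ (ω x)
    (TensorProduct.lift ((LinearMap.lsmul K g).compl₁₂ (ω y) LinearMap.id)))) hP
  simp only [map_sum, map_add, map_sub, TensorProduct.lift.tmul, LinearMap.compl₁₂_apply,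
    LinearMap.lsmul_apply, LinearMap.id_apply, map_zero, Finset.sum_add_distrib,
    Finset.sum_sub_distrib] at h
  have h₁ : ∑ i, ω x (mul (u i) (sharp ω u v y)) • v i
      = ∑ i, ∑ j, ω x (mul (u i) (u j)) • ω y (v j) • v i := by
    refine Finset.sum_congr rfl fun i _ => ?_
    have := map_sharp_of_symm ω hsymm (ω x ∘ₗ mul (u i)) y
    simp only [LinearMap.comp_apply, smul_eq_mul] at this
    rw [this, Finset.sum_smul]
    exact Finset.sum_congr rfl fun j _ => by rw [smul_smul, mul_comm]
  have h₂ : mul (sharp ω u v x) (sharp ω u v y)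
      = ∑ i, ∑ j, ω x (u i) • ω y (u j) • mul (v i) (v j) := by
    simp only [sharp_apply, map_sum, map_smul, LinearMap.sum_apply, LinearMap.smul_apply,
      Finset.smul_sum]
    rw [Finset.sum_comm]
    exact Finset.sum_congr rfl fun i _ => Finset.sum_congr rfl fun j _ => smul_comm _ _ _
  have h₃ : ∑ i, ω y (mul (u i) (sharp ω u v x)) • v i
      = ∑ i, ∑ j, ω x (u j) • ω y (mul (u i) (v j)) • v i := by
    refine Finset.sum_congr rfl fun i _ => ?_
    have := map_sharp ω u v (ω y ∘ₗ mul (u i)) x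
    simp only [LinearMap.comp_apply, smul_eq_mul] at this
    simp only [this, Finset.sum_smul, smul_smul]
  have h₄ : ∑ j, ω y (mul (sharp ω u v x) (u j)) • v j
      = ∑ i, ∑ j, ω x (u i) • ω y (mul (v i) (u j)) • v j := by
    rw [Finset.sum_comm]
    refine Finset.sum_congr rfl fun j _ => ?_
    have := map_sharp ω u v (ω y ∘ₗ mul.flip (u j)) x
    simp only [LinearMap.comp_apply, LinearMap.flip_apply, smul_eq_mul] at this
    simp only [this, Finset.sum_smul, smul_smul]
  simp only [add_smul, sub_smul, Finset.sum_add_distrib, Finset.sum_sub_distrib]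
  rw [h₁, h₂, h₃, h₄]
  rw [← sub_eq_zero, ← neg_eq_zero, ← h]
  abel

end

/-- in a symplectic perm algebra `(g,·,ω)`, a symmetric solution
`r` of the classical perm Yang-Baxter equation such that `ω` satisfies the
classical co-perm Yang-Baxter equation with respect to `Δ_r` gives rise to a
Nijenhuis operator `N(x) = Σᵢ ω(x,uᵢ) vᵢ` on `(g,·)`. -/
theorem stmt18 {K g : Type*} [Field K] [AddCommGroup g] [Module K g]
    {ι : Type*} [Fintype ι]
    (mul : g →ₗ[K] g →ₗ[K] g) (hm : IsPerm (fun x y => mul x y))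
    (ω : g →ₗ[K] g →ₗ[K] K) (hsym : ∀ x y : g, ω x y = ω y x)
    (hsymp : ∀ x y z : g,
      ω (mul x y) z + ω (mul x z) y = ω (mul z x) y + ω (mul z y) x)
    (u v : ι → g)
    (hsymm : ∑ i, v i ⊗ₜ[K] u i = ∑ i, u i ⊗ₜ[K] v i)
    (hP : ∑ i, ∑ j,
        (mul (u i) (u j) ⊗ₜ[K] (v j ⊗ₜ[K] v i)
          - u i ⊗ₜ[K] (u j ⊗ₜ[K] mul (v i) (v j))
          + u j ⊗ₜ[K] (mul (u i) (v j) ⊗ₜ[K] v i)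
          - u i ⊗ₜ[K] (mul (v i) (u j) ⊗ₜ[K] v j)) = (0 : g ⊗[K] (g ⊗[K] g)))
    (hybe : CoYBE (Dmap mul u v) ω) :
    IsNij (fun x y => mul x y) (fun x => ∑ i, ω x (u i) • v i) := by
  intro x y
  simp only [← sharp_apply]
  rw [mul_sharp_sharp hsymm hP]
  have key : ∀ i, ω x (mul (u i) (sharp ω u v y)) + ω y (mul (u i) (sharp ω u v x))
      - ω y (mul (sharp ω u v x) (u i))
      = ω (mul (sharp ω u v x) y + (mul x (sharp ω u v y) - sharp ω u v (mul x y))) (u i) := by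
    intro i
    have hd := form_defect_comm hsym hsymp hsymm hybe x y (u i)
    rw [map_add, LinearMap.add_apply, hd, map_sub, LinearMap.sub_apply,
      form_sharp_comm hsym hsymm]
    simp only [hsym _ (mul _ _)]
    linear_combination hsymp (u i) y (sharp ω u v x)
  simp only [key]
  rw [← sharp_apply, map_add, map_sub]
  abel
end
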